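/- Let (R, 𝔪) be a commutative noetherian complete Cohen-Macaulay local ring with canonical module. If the class of indecomposable maximal Cohen-Macaulay R-modules is of bounded h-length (there is b > 0 with l_R(h(M)) ≤ b for every indecomposable maximal Cohen-Macaulay R-module M), then R is of finite mCM type, i.e., there are only finitely many isomorphism classes of indecomposable maximal Cohen-Macaulay R-modules. -/

import Mathlib

universe u

open IsLocalRing

noncomputable section

namespace BT

/-- The length of a module, defined as the Krull dimension of its lattice of
submodules (which agrees with the usual composition-series length). -/
def moduleLength (A : Type u) [Ring A] (M : Type u) [AddCommGroup M] [Module A M] :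
    WithBot ℕ∞ :=
  Order.krullDim (Submodule A M)

/-- `M` is a maximal Cohen-Macaulay module over the local ring `R`: it admits an
`M`-regular sequence contained in the maximal ideal whose length is `dim R`
(i.e. `depth_R M = dim R`). -/
def IsMCM (R : Type u) [CommRing R] [IsLocalRing R]
    (M : Type u) [AddCommGroup M] [Module R M] : Prop :=
  ∃ rs : List R, (∀ r ∈ rs, r ∈ maximalIdeal R) ∧ RingTheory.Sequence.IsRegular M rs ∧
    (rs.length : WithBot ℕ∞) = ringKrullDim R

/-- The `n`-th Ext group of two `R`-modules. -/
def extGroup (R : Type u) [CommRing R] (n : ℕ)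
    (A B : Type u) [AddCommGroup A] [Module R A] [AddCommGroup B] [Module R B] : Type u :=
  ((Ext R (ModuleCat.{u} R) n).obj (Opposite.op (ModuleCat.of R A))).obj (ModuleCat.of R B)

instance (R : Type u) [CommRing R] (n : ℕ)
    (A B : Type u) [AddCommGroup A] [Module R A] [AddCommGroup B] [Module R B] :
    AddCommGroup (extGroup R n A B) :=
  inferInstanceAs (AddCommGroup
    (((Ext R (ModuleCat.{u} R) n).obj (Opposite.op (ModuleCat.of R A))).obj (ModuleCat.of R B)))

instance (R : Type u) [CommRing R] (n : ℕ)
    (A B : Type u) [AddCommGroup A] [Module R A] [AddCommGroup B] [Module R B] :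
    Module R (extGroup R n A B) :=
  inferInstanceAs (Module R
    (((Ext R (ModuleCat.{u} R) n).obj (Opposite.op (ModuleCat.of R A))).obj (ModuleCat.of R B)))

/-- `ω` is a canonical module for the Cohen-Macaulay local ring `R`: it is a
finitely generated module with `Ext^i_R(k, ω) = 0` for `i ≠ dim R` and
`Ext^{dim R}_R(k, ω) ≅ k`. -/
def IsCanonicalModule (R : Type u) [CommRing R] [IsLocalRing R]
    (ω : Type u) [AddCommGroup ω] [Module R ω] : Prop :=
  Module.Finite R ω ∧ ∃ d : ℕ, (d : WithBot ℕ∞) = ringKrullDim R ∧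
    (∀ i : ℕ, i ≠ d → Subsingleton (extGroup R i (ResidueField R) ω)) ∧
    Nonempty (extGroup R d (ResidueField R) ω ≃ₗ[R] ResidueField R)

/-- A homomorphism of `Λ`-modules factors through a projective `Λ`-module. -/
def FactorsThroughProjective (Λ : Type u) [Ring Λ] {M N : Type u}
    [AddCommGroup M] [Module Λ M] [AddCommGroup N] [Module Λ N] (f : M →ₗ[Λ] N) : Prop :=
  ∃ (P : Type u) (_ : AddCommGroup P) (_ : Module Λ P), Module.Projective Λ P ∧
    ∃ (g : M →ₗ[Λ] P) (h : P →ₗ[Λ] N), h.comp g = f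

section StableHom

variable (R : Type u) [CommRing R] (Λ : Type u) [Ring Λ] [Algebra R Λ]
variable (M N : Type u) [AddCommGroup M] [Module Λ M]
  [AddCommGroup N] [Module Λ N] [Module R N] [IsScalarTower R Λ N]

/-- The `R`-submodule of `Hom_Λ(M, N)` consisting of the homomorphisms that
factor through a projective `Λ`-module. -/
def projTrivial : Submodule R (M →ₗ[Λ] N) where
  carrier := {f | FactorsThroughProjective Λ f}
  zero_mem' := ⟨Λ, inferInstance, inferInstance, inferInstance, 0, 0, by ext; simp⟩
  add_mem' := by
    rintro f₁ f₂ ⟨P₁, _, _, hP₁, g₁, h₁, rfl⟩ ⟨P₂, _, _, hP₂, g₂, h₂, rfl⟩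
    exact ⟨P₁ × P₂, inferInstance, inferInstance, inferInstance,
      g₁.prod g₂, h₁.comp (LinearMap.fst Λ P₁ P₂) + h₂.comp (LinearMap.snd Λ P₁ P₂),
      by ext m; simp⟩
  smul_mem' := by
    rintro r f ⟨P, _, _, hP, g, h, rfl⟩
    exact ⟨P, inferInstance, inferInstance, hP, g, r • h, by ext m; simp⟩

/-- The stable Hom `Hom-bar_Λ(M, N)`: homomorphisms modulo those factoring
through projectives, as an `R`-module. -/
def stableHom : Type u := (M →ₗ[Λ] N) ⧸ projTrivial R Λ M N

instance : AddCommGroup (stableHom R Λ M N) :=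
  inferInstanceAs (AddCommGroup ((M →ₗ[Λ] N) ⧸ projTrivial R Λ M N))

instance : Module R (stableHom R Λ M N) :=
  inferInstanceAs (Module R ((M →ₗ[Λ] N) ⧸ projTrivial R Λ M N))

end StableHom

/-- The `h`-length of `M` (relative to a fixed module `G`): the length over `R`
of `h(M) = Hom-bar_Λ(M, M ⊕ G)`. -/
def hLength (R : Type u) [CommRing R] (Λ : Type u) [Ring Λ] [Algebra R Λ]
    (M : Type u) [AddCommGroup M] [Module Λ M] [Module R M] [IsScalarTower R Λ M]
    (G : Type u) [AddCommGroup G] [Module Λ G] [Module R G] [IsScalarTower R Λ G] :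
    WithBot ℕ∞ :=
  moduleLength R (stableHom R Λ M (M × G))

/-- A module is indecomposable if it is nonzero and admits no nontrivial direct
sum decomposition. -/
def IsIndecomposable (Λ : Type u) [Ring Λ] (M : Type u) [AddCommGroup M] [Module Λ M] : Prop :=
  Nontrivial M ∧ ∀ A B : Submodule Λ M, IsCompl A B → A = ⊥ ∨ B = ⊥

/-- `Ext¹_Λ(M, Y) = 0`, expressed by the splitting of extensions: every
surjection onto `M` with kernel isomorphic to `Y` splits. -/
def Ext1Vanishes (Λ : Type u) [Ring Λ] (M Y : Type u)
    [AddCommGroup M] [Module Λ M] [AddCommGroup Y] [Module Λ Y] : Prop :=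
  ∀ (E : Type u) (_ : AddCommGroup E) (_ : Module Λ E) (g : E →ₗ[Λ] M),
    Function.Surjective g → Nonempty ((LinearMap.ker g) ≃ₗ[Λ] Y) →
      ∃ s : M →ₗ[Λ] E, g.comp s = LinearMap.id

/-- A homomorphism `f : X → C` is right minimal if every endomorphism `g` of `X`
with `f ∘ g = f` is an isomorphism. -/
def RightMinimal (Λ : Type u) [Ring Λ] {X C : Type u} [AddCommGroup X] [Module Λ X]
    [AddCommGroup C] [Module Λ C] (f : X →ₗ[Λ] C) : Prop :=
  ∀ g : X →ₗ[Λ] X, f.comp g = f → Function.Bijective g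

/-- `M` is an `R`-lattice over the commutative local ring `R`: a finitely
generated maximal Cohen-Macaulay module that is free on the punctured
spectrum of `R`. -/
def IsLatticeC (R : Type u) [CommRing R] [IsLocalRing R]
    (M : Type u) [AddCommGroup M] [Module R M] : Prop :=
  Module.Finite R M ∧ IsMCM R M ∧
    ∀ (p : Ideal R) [p.IsPrime], p ≠ maximalIdeal R →
      Module.Free (Localization.AtPrime p) (LocalizedModule p.primeCompl M)

/-- The `h`-length of an `R`-module `M` (relative to `G`): the length over `R`
of `Hom-bar_R(M, M ⊕ G)`. -/
def hLengthC (R : Type u) [CommRing R] (M : Type u) [AddCommGroup M] [Module R M]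
    (G : Type u) [AddCommGroup G] [Module R G] : WithBot ℕ∞ :=
  hLength R R M G

/-- `Y` is a lat-injective `R`-module: a lattice with `Ext¹_R(M, Y) = 0` for
every `R`-lattice `M`. -/
def IsLatInjectiveC (R : Type u) [CommRing R] [IsLocalRing R]
    (Y : Type u) [AddCommGroup Y] [Module R Y] : Prop :=
  IsLatticeC R Y ∧ ∀ (M : Type u) (_ : AddCommGroup M) (_ : Module R M),
    IsLatticeC R M → Ext1Vanishes R M Y

/-- `Y` admits a finite resolution `0 → L_t → ⋯ → L_0 → Y → 0` by lat-injective
`R`-modules. -/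
def HasLatInjResOfLengthC (R : Type u) [CommRing R] [IsLocalRing R] :
    ℕ → ∀ (Y : Type u) [AddCommGroup Y] [Module R Y], Prop
  | 0, Y, _, _ => IsLatInjectiveC R Y
  | (t + 1), Y, _, _ =>
      ∃ (L : Type u) (_ : AddCommGroup L) (_ : Module R L) (π : L →ₗ[R] Y),
        IsLatInjectiveC R L ∧ Function.Surjective π ∧
          HasLatInjResOfLengthC R t (LinearMap.ker π)

/-- `α : X → C` is a minimal lat-approximation of the `R`-module `C`. -/
def IsMinimalLatApproxC (R : Type u) [CommRing R] [IsLocalRing R]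
    {X : Type u} [AddCommGroup X] [Module R X]
    {C : Type u} [AddCommGroup C] [Module R C] (α : X →ₗ[R] C) : Prop :=
  IsLatticeC R X ∧ Function.Surjective α ∧
    (∃ t : ℕ, HasLatInjResOfLengthC R t (LinearMap.ker α)) ∧ RightMinimal R α

/-- `α : G → k` is a minimal lat-approximation of the residue field of `R`. -/
def IsResidueApprox (R : Type u) [CommRing R] [IsLocalRing R]
    (G : Type u) [AddCommGroup G] [Module R G] (α : G →ₗ[R] ResidueField R) : Prop :=
  IsMinimalLatApproxC R α

/-- There are infinitely many pairwise non-isomorphic indecomposable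
`R`-lattices of `h`-length `t`. -/
def InfManyIndecLatticesOfHLengthC (R : Type u) [CommRing R] [IsLocalRing R]
    (G : Type u) [AddCommGroup G] [Module R G] (t : ℕ) : Prop :=
  ∃ (F : ℕ → Type u) (_ : ∀ n, AddCommGroup (F n)) (_ : ∀ n, Module R (F n)),
    (∀ n, IsLatticeC R (F n) ∧ IsIndecomposable R (F n) ∧
      hLengthC R (F n) G = (t : WithBot ℕ∞)) ∧
    ∀ m n : ℕ, m ≠ n → IsEmpty (F m ≃ₗ[R] F n)

/-- `R` has strongly unbounded lattice type. -/
def StronglyUnboundedLatTypeC (R : Type u) [CommRing R] [IsLocalRing R]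
    (G : Type u) [AddCommGroup G] [Module R G] : Prop :=
  ∃ b : ℕ → ℕ, StrictMono b ∧ ∀ i, InfManyIndecLatticesOfHLengthC R G (b i)

/-- `R` is of finite lattice type: there are only finitely many isomorphism
classes of indecomposable `R`-lattices. -/
def FiniteLatTypeC (R : Type u) [CommRing R] [IsLocalRing R] : Prop :=
  ∃ (n : ℕ) (F : Fin n → Type u) (_ : ∀ i, AddCommGroup (F i)) (_ : ∀ i, Module R (F i)),
    ∀ (M : Type u) (_ : AddCommGroup M) (_ : Module R M),
      IsLatticeC R M → IsIndecomposable R M → ∃ i, Nonempty (M ≃ₗ[R] F i)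

/-- `R` is of bounded lattice type: there is `b > 0` with `ℓ(h(M)) < b` for
every indecomposable `R`-lattice `M`. -/
def BoundedLatTypeC (R : Type u) [CommRing R] [IsLocalRing R]
    (G : Type u) [AddCommGroup G] [Module R G] : Prop :=
  ∃ b : ℕ, 0 < b ∧ ∀ (M : Type u) (_ : AddCommGroup M) (_ : Module R M),
    IsLatticeC R M → IsIndecomposable R M → hLengthC R M G < (b : WithBot ℕ∞)

/-- `R` is of finite maximal Cohen-Macaulay type: there are only finitely many
isomorphism classes of indecomposable maximal Cohen-Macaulay `R`-modules. -/
def FiniteMCMType (R : Type u) [CommRing R] [IsLocalRing R] : Prop :=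
  ∃ (n : ℕ) (F : Fin n → Type u) (_ : ∀ i, AddCommGroup (F i)) (_ : ∀ i, Module R (F i)),
    ∀ (M : Type u) (_ : AddCommGroup M) (_ : Module R M),
      Module.Finite R M → IsMCM R M → IsIndecomposable R M → ∃ i, Nonempty (M ≃ₗ[R] F i)

/-- `R` is of bounded maximal Cohen-Macaulay type: the betti numbers (minimal
numbers of generators) of the indecomposable maximal Cohen-Macaulay
`R`-modules are bounded. -/
def BoundedMCMType (R : Type u) [CommRing R] [IsLocalRing R] : Prop :=
  ∃ b : ℕ, ∀ (M : Type u) (_ : AddCommGroup M) (_ : Module R M),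
    Module.Finite R M → IsMCM R M → IsIndecomposable R M →
      ∃ π : (Fin b → R) →ₗ[R] M, Function.Surjective π

/-- `A` is a regular local ring: a noetherian local ring whose maximal ideal
is generated by `dim A` elements. -/
def IsRegularLocal (A : Type u) [CommRing A] [IsLocalRing A] : Prop :=
  IsNoetherianRing A ∧ ∃ s : Finset A, Ideal.span (s : Set A) = maximalIdeal A ∧
    (s.card : WithBot ℕ∞) = ringKrullDim A

section WeaklyRegular

open RingTheory.Sequence Function Pointwise

variable {R : Type u} [CommRing R]
variable {A B C : Type u} [AddCommGroup A] [Module R A] [AddCommGroup B] [Module R B]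
  [AddCommGroup C] [Module R C]

lemma quotSMulTop_map_injective_of_isSMulRegular {f : A →ₗ[R] B} {g : B →ₗ[R] C} {r : R}
    (hf : Injective f) (hfg : Exact f g) (hr : IsSMulRegular C r) :
    Injective (QuotSMulTop.map r f) := by
  have h0 : Exact (0 : PUnit.{u+1} →ₗ[R] A) f := by
    intro x
    rw [map_eq_zero_iff f hf]
    constructor
    · rintro rfl
      exact ⟨0, by simp⟩
    · rintro ⟨y, rfl⟩
      simp
  have h1 := QuotSMulTop.map_first_exact_on_four_term_exact_of_isSMulRegular_last h0 hfg hr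
  rw [injective_iff_map_eq_zero]
  intro x hx
  obtain ⟨y, rfl⟩ := (h1 x).1 hx
  simp

lemma isWeaklyRegular_of_exact (rs : List R) {f : A →ₗ[R] B} {g : B →ₗ[R] C}
    (hf : Injective f) (hfg : Exact f g) (hg : Surjective g)
    (hA : IsWeaklyRegular A rs) (hC : IsWeaklyRegular C rs) : IsWeaklyRegular B rs := by
  induction rs generalizing A B C with
  | nil => simp
  | cons r rs ih =>
    rw [isWeaklyRegular_cons_iff] at hA hC ⊢
    refine ⟨?_, ih (f := QuotSMulTop.map r f) (g := QuotSMulTop.map r g)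
      (quotSMulTop_map_injective_of_isSMulRegular hf hfg hC.1) (QuotSMulTop.map_exact r hfg hg)
      (QuotSMulTop.map_surjective r hg) hA.2 hC.2⟩
    rw [isSMulRegular_iff_right_eq_zero_of_smul]
    intro x hx
    have : g x = 0 := hC.1.right_eq_zero_of_smul (by rw [← map_smul, hx, map_zero])
    obtain ⟨y, rfl⟩ := (hfg x).1 this
    rw [← map_smul, map_eq_zero_iff f hf] at hx
    rw [hA.1.right_eq_zero_of_smul hx, map_zero]

lemma isWeaklyRegular_of_exact_left (rs : List R) {f : A →ₗ[R] B} {g : B →ₗ[R] C}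
    (hf : Injective f) (hfg : Exact f g) (hg : Surjective g)
    (hB : IsWeaklyRegular B rs) (hC : IsWeaklyRegular C rs) : IsWeaklyRegular A rs := by
  induction rs generalizing A B C with
  | nil => simp
  | cons r rs ih =>
    rw [isWeaklyRegular_cons_iff] at hB hC ⊢
    exact ⟨hB.1.of_injective f hf, ih (f := QuotSMulTop.map r f) (g := QuotSMulTop.map r g)
      (quotSMulTop_map_injective_of_isSMulRegular hf hfg hC.1) (QuotSMulTop.map_exact r hfg hg)
      (QuotSMulTop.map_surjective r hg) hB.2 hC.2⟩

lemma isWeaklyRegular_of_retract (rs : List R) {i : A →ₗ[R] B} {p : B →ₗ[R] A}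
    (h : p ∘ₗ i = LinearMap.id) (hB : IsWeaklyRegular B rs) : IsWeaklyRegular A rs := by
  induction rs generalizing A B with
  | nil => simp
  | cons r rs ih =>
    rw [isWeaklyRegular_cons_iff] at hB ⊢
    refine ⟨hB.1.of_injective i (LeftInverse.injective (g := p) fun x => LinearMap.congr_fun h x),
      ih (i := QuotSMulTop.map r i) (p := QuotSMulTop.map r p) ?_ hB.2⟩
    rw [← QuotSMulTop.map_comp, h, QuotSMulTop.map_id]

lemma isWeaklyRegular_of_subsingleton [Subsingleton A] (rs : List R) : IsWeaklyRegular A rs := by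
  induction rs generalizing A with
  | nil => simp
  | cons r rs ih =>
    rw [isWeaklyRegular_cons_iff]
    exact ⟨fun _ _ _ => Subsingleton.elim _ _, ih⟩

lemma isWeaklyRegular_of_projective [Module.Projective R A] {rs : List R}
    (h : IsWeaklyRegular R rs) : IsWeaklyRegular A rs :=
  ((TensorProduct.lid R A).isWeaklyRegular_congr rs).1 h.isWeaklyRegular_rTensor

/-- Powers of a weakly regular sequence are weakly regular. -/
lemma isWeaklyRegular_map_pow (rs : List R) (n : ℕ) (h : IsWeaklyRegular A rs) :
    IsWeaklyRegular A (rs.map (· ^ n)) := by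
  induction rs generalizing A with
  | nil => simp
  | cons r rs ih =>
    rw [isWeaklyRegular_cons_iff] at h
    rw [List.map_cons, isWeaklyRegular_cons_iff]
    refine ⟨h.1.pow n, ?_⟩
    have h2 := ih h.2
    generalize hl : rs.map (· ^ n) = l at *
    clear hl ih
    have key : ∀ j, IsWeaklyRegular (QuotSMulTop (r ^ j) A) l := by
      intro j
      induction j with
      | zero =>
        have : Subsingleton (QuotSMulTop (r ^ 0) A) := by
          rw [pow_zero, Submodule.Quotient.subsingleton_iff, one_smul]
        exact isWeaklyRegular_of_subsingleton _
      | succ j ihj =>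
        have hle : (r ^ j) • (⊤ : Submodule R A) ≤
            ((r ^ (j + 1)) • (⊤ : Submodule R A)).comap (LinearMap.lsmul R A r) := by
          rintro _ ⟨y, -, rfl⟩
          exact ⟨y, trivial, by simpa [pow_succ', mul_smul] using smul_comm _ _ _⟩
        have hle2 : (r ^ (j + 1)) • (⊤ : Submodule R A) ≤ r • (⊤ : Submodule R A) := by
          rintro _ ⟨y, -, rfl⟩
          exact ⟨r ^ j • y, trivial, by simpa [pow_succ', mul_smul] using smul_comm _ _ _⟩
        refine isWeaklyRegular_of_exact l
          (f := Submodule.mapQ (r ^ j • ⊤) (r ^ (j + 1) • ⊤) (LinearMap.lsmul R A r) hle)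
          (g := Submodule.factor hle2) ?_ ?_ ?_ ihj h2
        · rw [injective_iff_map_eq_zero]
          intro x hx
          obtain ⟨x, rfl⟩ := Submodule.Quotient.mk_surjective _ x
          rw [Submodule.mapQ_apply, Submodule.Quotient.mk_eq_zero] at hx
          obtain ⟨y, -, hy⟩ := hx
          rw [Submodule.Quotient.mk_eq_zero]
          refine ⟨y, trivial, h.1 ?_⟩
          simpa [pow_succ', mul_smul] using hy
        · intro x
          obtain ⟨x, rfl⟩ := Submodule.Quotient.mk_surjective _ x
          constructor
          · intro hx
            have hx' : x ∈ r • (⊤ : Submodule R A) := by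
              rw [← Submodule.Quotient.mk_eq_zero]; exact hx
            obtain ⟨y, -, rfl⟩ := hx'
            exact ⟨Submodule.Quotient.mk y, rfl⟩
          · rintro ⟨y, hy⟩
            obtain ⟨y, rfl⟩ := Submodule.Quotient.mk_surjective _ y
            rw [← hy]
            exact (Submodule.Quotient.mk_eq_zero _).2 ⟨y, trivial, rfl⟩
        · exact Submodule.factor_surjective hle2
    exact key n

end WeaklyRegular

section Depth

open RingTheory.Sequence CategoryTheory Abelian

variable (R : Type u) [CommRing R] [IsLocalRing R]

/-- `depth M ≥ n`, expressed by vanishing of Ext groups. -/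
def ExtDepth (n : ℕ) (M : Type u) [AddCommGroup M] [Module R M] : Prop :=
  ∀ i < n, Subsingleton (Ext (ModuleCat.of R (R ⧸ maximalIdeal R)) (ModuleCat.of R M) i)

variable {R}
variable {M : Type u} [AddCommGroup M] [Module R M]

lemma support_quotient_maximalIdeal :
    Module.support R (ModuleCat.of R (R ⧸ maximalIdeal R)) =
      PrimeSpectrum.zeroLocus (maximalIdeal R : Set R) := by
  change Module.support R (R ⧸ maximalIdeal R) = _
  rw [Module.support_eq_zeroLocus, Ideal.annihilator_quotient]

lemma maximalIdeal_smul_lt_top [Module.Finite R M] [Nontrivial M] :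
    maximalIdeal R • (⊤ : Submodule R M) < ⊤ :=
  (Submodule.top_ne_ideal_smul_of_le_jacobson_annihilator
    (maximalIdeal_le_jacobson _)).symm.lt_top

lemma extDepth_of_isRegular [IsNoetherianRing R] [Module.Finite R M] (rs : List R)
    (mem : ∀ r ∈ rs, r ∈ maximalIdeal R) (reg : IsRegular M rs) : ExtDepth R rs.length M := by
  have := reg.nontrivial
  intro i hi
  exact ModuleCat.subsingleton_ext_of_exists_isRegular (maximalIdeal R)
    (Nfin := inferInstanceAs (Module.Finite R (R ⧸ maximalIdeal R)))
    (ModuleCat.of R (R ⧸ maximalIdeal R)) support_quotient_maximalIdeal.subset (ModuleCat.of R M)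
    maximalIdeal_smul_lt_top rs mem reg i hi

lemma ExtDepth.exists_isSMulRegular [IsNoetherianRing R] [Module.Finite R M] [Nontrivial M] {n : ℕ}
    (h : ExtDepth R (n + 1) M) : ∃ r ∈ maximalIdeal R, IsSMulRegular M r := by
  have : Module.Finite R (ModuleCat.of R (R ⧸ maximalIdeal R)) :=
    inferInstanceAs (Module.Finite R (R ⧸ maximalIdeal R))
  obtain ⟨rs, hl, hm, hr⟩ := ModuleCat.exists_isRegular_of_exists_subsingleton_ext
    (maximalIdeal R) 1 (ModuleCat.of R M) maximalIdeal_smul_lt_top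
    (ModuleCat.of R (R ⧸ maximalIdeal R)) support_quotient_maximalIdeal
    (fun i hi => h i (by omega))
  obtain ⟨r, rfl⟩ := List.length_eq_one_iff.1 hl
  exact ⟨r, hm r (by simp), ((isRegular_cons_iff M r []).1 hr).1⟩

lemma ExtDepth.quotSMulTop {n : ℕ} (h : ExtDepth R (n + 1) M) {x : R} (hx : IsSMulRegular M x) :
    ExtDepth R n (QuotSMulTop x M) := by
  intro i hi
  have zero1 := AddCommGrpCat.isZero_of_iff_subsingleton.mpr (h i (by omega))
  have zero2 := AddCommGrpCat.isZero_of_iff_subsingleton.mpr (h (i + 1) (by omega))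
  have hx' : IsSMulRegular (ModuleCat.of R M) x := hx
  exact AddCommGrpCat.subsingleton_of_isZero <| ShortComplex.Exact.isZero_of_both_zeros
    ((Ext.covariant_sequence_exact₃' (ModuleCat.of R (R ⧸ maximalIdeal R))
      hx'.smulShortComplex_shortExact) i (i + 1) rfl)
    (zero1.eq_zero_of_src _) (zero2.eq_zero_of_tgt _)

/-- If all elements of a power of the maximal ideal act on `M` through modules on which `ys` is
weakly regular, and `M` has depth at least the length of `ys`, then `ys` is weakly regular
on `M`. -/
lemma isWeaklyRegular_of_extDepth [IsNoetherianRing R] [Module.Finite R M] [Nontrivial M] (a : ℕ) (ys : List R)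
    (hys : ∀ y ∈ ys, y ∈ maximalIdeal R) (hd : ExtDepth R ys.length M)
    (hfac : ∀ r ∈ maximalIdeal R ^ a, ∃ (F : Type u) (_ : AddCommGroup F) (_ : Module R F)
      (g : M →ₗ[R] F) (h : F →ₗ[R] M), IsWeaklyRegular F ys ∧ h ∘ₗ g = r • LinearMap.id) :
    IsWeaklyRegular M ys := by
  induction ys generalizing M with
  | nil => simp
  | cons y ys ih =>
    obtain ⟨r, hr, hreg⟩ := hd.exists_isSMulRegular
    obtain ⟨F, _, _, g, h, hF, hgh⟩ := hfac (r ^ a) (Ideal.pow_mem_pow hr a)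
    have hg : Function.Injective g := by
      have : Function.Injective (h ∘ₗ g) := by
        rw [hgh]; exact hreg.pow a
      exact Function.Injective.of_comp (f := h) this
    have hyM : IsSMulRegular M y := ((isWeaklyRegular_cons_iff F y ys).1 hF).1.of_injective g hg
    rw [isWeaklyRegular_cons_iff]
    have := nontrivial_quotSMulTop_of_mem_maximalIdeal M (hys y (by simp))
    refine ⟨hyM, ih (fun z hz => hys z (by simp [hz])) (hd.quotSMulTop hyM) fun s hs => ?_⟩
    obtain ⟨F, _, _, g, h, hF, hgh⟩ := hfac s hs
    refine ⟨QuotSMulTop y F, inferInstance, inferInstance, QuotSMulTop.map y g,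
      QuotSMulTop.map y h, ((isWeaklyRegular_cons_iff F y ys).1 hF).2, ?_⟩
    rw [← QuotSMulTop.map_comp, hgh, map_smul, QuotSMulTop.map_id]

end Depth

section Decomposition

variable {R : Type u} [CommRing R] {M N : Type u} [AddCommGroup M] [Module R M]
  [AddCommGroup N] [Module R N]

lemma IsIndecomposable.eq_zero_or_eq_id (hM : IsIndecomposable R M) {e : M →ₗ[R] M}
    (he : e ∘ₗ e = e) : e = 0 ∨ e = LinearMap.id := by
  have he' : IsIdempotentElem e := he
  rcases hM.2 _ _ (LinearMap.IsIdempotentElem.isCompl he').symm with h | h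
  · exact Or.inr (LinearMap.ext fun x => (LinearMap.ker_eq_bot.1 h) (LinearMap.congr_fun he x))
  · exact Or.inl (LinearMap.range_eq_bot.1 h)

lemma isIndecomposable_of_idempotents [Nontrivial M]
    (h : ∀ e : M →ₗ[R] M, e ∘ₗ e = e → e = 0 ∨ e = LinearMap.id) : IsIndecomposable R M := by
  refine ⟨inferInstance, fun A B hAB => ?_⟩
  rcases h _ (Submodule.isIdempotentElem_projection hAB) with h | h
  · left
    rw [← Submodule.range_projection hAB, h, LinearMap.range_zero]
  · right
    rw [← Submodule.ker_projection hAB, h, LinearMap.ker_id]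

lemma IsIndecomposable.bijective_of_leftInverse (hM : IsIndecomposable R M) [Nontrivial N]
    {i : N →ₗ[R] M} {p : M →ₗ[R] N} (h : p ∘ₗ i = LinearMap.id) : Function.Bijective i := by
  have hl : Function.LeftInverse p i := fun x => LinearMap.congr_fun h x
  rcases hM.eq_zero_or_eq_id (e := i ∘ₗ p)
    (by rw [LinearMap.comp_assoc, ← LinearMap.comp_assoc p, h, LinearMap.id_comp]) with h0 | h0
  · exfalso
    obtain ⟨x, hx⟩ := exists_ne (0 : N)
    apply hx
    rw [← hl x, ← hl (p (i x))]
    have := LinearMap.congr_fun h0 (i x)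
    rw [LinearMap.comp_apply] at this
    rw [this]
    simp
  · exact ⟨hl.injective, fun x => ⟨p x, LinearMap.congr_fun h0 x⟩⟩

lemma rangeRestrict_comp_subtype {e : M →ₗ[R] M} (he : e ∘ₗ e = e) :
    e.rangeRestrict ∘ₗ (LinearMap.range e).subtype = LinearMap.id := by
  ext ⟨_, y, rfl⟩
  exact LinearMap.congr_fun he y

lemma exists_indecomposable_idempotents_aux [IsNoetherian R M] (K : Submodule R M) :
    ∀ e : M →ₗ[R] M, e ∘ₗ e = e → LinearMap.ker e = K →
      ∃ l : List (M →ₗ[R] M), (∀ f ∈ l, f ∘ₗ f = f ∧ IsIndecomposable R (LinearMap.range f)) ∧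
        l.sum = e := by
  induction K using WellFoundedGT.induction with
  | ind K ih =>
    rintro e he rfl
    by_cases h0 : e = 0
    · exact ⟨[], by simp, by simp [h0]⟩
    have : Nontrivial (LinearMap.range e) :=
      Submodule.nontrivial_iff_ne_bot.2 fun h => h0 (LinearMap.range_eq_bot.1 h)
    by_cases hI : IsIndecomposable R (LinearMap.range e)
    · exact ⟨[e], by simpa using ⟨he, hI⟩, by simp⟩
    obtain ⟨p, hp, hp0, hp1⟩ : ∃ p : LinearMap.range e →ₗ[R] LinearMap.range e,
        p ∘ₗ p = p ∧ p ≠ 0 ∧ p ≠ LinearMap.id := by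
      by_contra! hcon
      exact hI (isIndecomposable_of_idempotents fun f hf => or_iff_not_imp_left.2 (hcon f hf))
    have key : ∀ q : LinearMap.range e →ₗ[R] LinearMap.range e, q ∘ₗ q = q → q ≠ LinearMap.id →
        ∃ l : List (M →ₗ[R] M),
          (∀ f ∈ l, f ∘ₗ f = f ∧ IsIndecomposable R (LinearMap.range f)) ∧
          l.sum = (LinearMap.range e).subtype ∘ₗ q ∘ₗ e.rangeRestrict := by
      intro q hq hq1
      refine ih (LinearMap.ker ((LinearMap.range e).subtype ∘ₗ q ∘ₗ e.rangeRestrict)) ?_ _ ?_ rfl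
      · refine lt_of_le_of_ne ?_ ?_
        · intro x hx
          have : e.rangeRestrict x = 0 := Subtype.ext (by simpa using hx)
          simp [this]
        · intro heq
          apply hq1
          ext y
          obtain ⟨x, rfl⟩ := e.surjective_rangeRestrict y
          have hqq : q (q (e.rangeRestrict x) - e.rangeRestrict x) = 0 := by
            rw [map_sub, sub_eq_zero]
            exact LinearMap.congr_fun hq _
          have hmem : ((q (e.rangeRestrict x) - e.rangeRestrict x : LinearMap.range e) : M) ∈
              LinearMap.ker e := by
            rw [heq, LinearMap.mem_ker, LinearMap.comp_apply, LinearMap.comp_apply]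
            have h2 := LinearMap.congr_fun (rangeRestrict_comp_subtype he)
              (q (e.rangeRestrict x) - e.rangeRestrict x)
            rw [LinearMap.comp_apply] at h2
            rw [show e.rangeRestrict ((q (e.rangeRestrict x) - e.rangeRestrict x :
              LinearMap.range e) : M) = _ from h2, LinearMap.id_apply, hqq, map_zero]
          rw [LinearMap.mem_ker] at hmem
          have h2 := LinearMap.congr_fun (rangeRestrict_comp_subtype he)
              (q (e.rangeRestrict x) - e.rangeRestrict x)
          rw [LinearMap.comp_apply, LinearMap.id_apply] at h2
          have h3 := congrArg Subtype.val h2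
          rw [LinearMap.codRestrict_apply, Submodule.subtype_apply, hmem] at h3
          have h4 := h3.symm
          simpa [sub_eq_zero] using h4
      · rw [LinearMap.comp_assoc, LinearMap.comp_assoc, ← LinearMap.comp_assoc _ _ e.rangeRestrict,
          rangeRestrict_comp_subtype he, LinearMap.id_comp, ← LinearMap.comp_assoc e.rangeRestrict q q, hq]
    obtain ⟨l₁, h₁, hs₁⟩ := key p hp hp1
    obtain ⟨l₂, h₂, hs₂⟩ := key (LinearMap.id - p)
      (by ext x; have := LinearMap.congr_fun hp x; simp at this; simp [this])
      (by intro h; apply hp0; rw [← sub_sub_self LinearMap.id p, h, sub_self])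
    refine ⟨l₁ ++ l₂, ?_, ?_⟩
    · intro f hf
      rcases List.mem_append.1 hf with hf | hf
      exacts [h₁ f hf, h₂ f hf]
    · rw [List.sum_append, hs₁, hs₂]
      ext x
      simp

/-- A noetherian module is a finite direct sum of indecomposables. -/
lemma exists_indecomposable_idempotents (R : Type u) [CommRing R] (M : Type u) [AddCommGroup M]
    [Module R M] [IsNoetherian R M] :
    ∃ l : List (M →ₗ[R] M), (∀ f ∈ l, f ∘ₗ f = f ∧ IsIndecomposable R (LinearMap.range f)) ∧
        l.sum = LinearMap.id :=
  exists_indecomposable_idempotents_aux _ _ (LinearMap.id_comp _) rfl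

lemma list_sum_apply (l : List (M →ₗ[R] N)) (x : M) : l.sum x = (l.map fun f => f x).sum := by
  induction l with
  | nil => simp
  | cons a l ih => simp [ih]

end Decomposition

section Stable

variable {R : Type u} [CommRing R] {A B C M N : Type u} [AddCommGroup A] [Module R A]
  [AddCommGroup B] [Module R B] [AddCommGroup C] [Module R C] [AddCommGroup M] [Module R M]
  [AddCommGroup N] [Module R N]

lemma FactorsThroughProjective.comp_left {f : A →ₗ[R] B} (hf : FactorsThroughProjective R f)
    (g : B →ₗ[R] C) : FactorsThroughProjective R (g ∘ₗ f) := by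
  obtain ⟨P, _, _, hP, a, c, rfl⟩ := hf
  exact ⟨P, _, _, hP, a, g ∘ₗ c, rfl⟩

lemma FactorsThroughProjective.comp_right {f : B →ₗ[R] C} (hf : FactorsThroughProjective R f)
    (g : A →ₗ[R] B) : FactorsThroughProjective R (f ∘ₗ g) := by
  obtain ⟨P, _, _, hP, a, c, rfl⟩ := hf
  exact ⟨P, _, _, hP, a ∘ₗ g, c, rfl⟩

lemma FactorsThroughProjective.list_sum {l : List (A →ₗ[R] B)}
    (h : ∀ f ∈ l, FactorsThroughProjective R f) : FactorsThroughProjective R l.sum :=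
  (projTrivial R R A B).list_sum_mem h

variable (R M) in
/-- All elements of the ideal `I` act on `M` through projectives. -/
def StablyKilled (I : Ideal R) : Prop :=
  ∀ r ∈ I, FactorsThroughProjective R (r • (LinearMap.id : M →ₗ[R] M))

lemma StablyKilled.of_idempotents {I : Ideal R} {l : List (M →ₗ[R] M)}
    (hsum : l.sum = LinearMap.id)
    (h : ∀ f ∈ l, StablyKilled R (LinearMap.range f) I) : StablyKilled R M I := by
  intro r hr
  rw [← hsum, List.smul_sum]
  refine FactorsThroughProjective.list_sum fun g hg => ?_
  obtain ⟨f, hf, rfl⟩ := List.mem_map.1 hg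
  have := ((h f hf r hr).comp_left (LinearMap.range f).subtype).comp_right f.rangeRestrict
  convert this using 1
  ext x
  simp

lemma StablyKilled.of_subsingleton [Subsingleton M] (I : Ideal R) : StablyKilled R M I := by
  intro r _
  rw [Subsingleton.elim (r • LinearMap.id) (0 : M →ₗ[R] M)]
  exact (projTrivial R R M M).zero_mem

end Stable

section Length

variable {R : Type u} [CommRing R] {M : Type u} [AddCommGroup M] [Module R M]

lemma pow_smul_eq_zero_of_length_le [IsLocalRing R] {n : ℕ} (h : Module.length R M ≤ n) {r : R}
    (hr : r ∈ maximalIdeal R ^ n) (x : M) : r • x = 0 := by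
  induction n generalizing M r with
  | zero =>
    have : Subsingleton M := Module.length_eq_zero_iff.1 (by simpa using h)
    exact Subsingleton.elim _ _
  | succ n ih =>
    have hfl : IsFiniteLength R M := Module.length_ne_top_iff.1
      (ne_top_of_le_ne_top (ENat.natCast_ne_top _) h)
    obtain ⟨_, _⟩ := isFiniteLength_iff_isNoetherian_isArtinian.1 hfl
    rcases subsingleton_or_nontrivial M with hM | hM
    · exact Subsingleton.elim _ _
    have hlt := Submodule.length_lt (maximalIdeal_smul_lt_top (R := R) (M := M)).ne
    have hle : Module.length R (maximalIdeal R • (⊤ : Submodule R M) : Submodule R M) ≤ n := by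
      have := hlt.trans_le h
      push_cast at this
      exact Order.le_of_lt_add_one this
    rw [pow_succ] at hr
    refine Submodule.mul_induction_on hr (fun a ha c hc => ?_) fun a c ha hc => by
      rw [add_smul, ha, hc, add_zero]
    have := ih hle ha ⟨c • x, Submodule.smul_mem_smul hc trivial⟩
    rw [mul_smul]
    exact congrArg Subtype.val this

variable (G : Type u) [AddCommGroup G] [Module R G]

lemma length_stableHom_le {b : ℕ} (h : hLengthC R M G ≤ (b : WithBot ℕ∞)) :
    Module.length R (stableHom R R M (M × G)) ≤ b := by
  have h' : (Module.length R (stableHom R R M (M × G)) : WithBot ℕ∞) ≤ ((b : ℕ∞) : WithBot ℕ∞) := by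
    rw [Module.coe_length]; exact h
  exact WithBot.coe_le_coe.1 h'

lemma stablyKilled_of_hLengthC_le [IsLocalRing R] {b : ℕ} (h : hLengthC R M G ≤ (b : WithBot ℕ∞)) :
    StablyKilled R M (maximalIdeal R ^ b) := by
  intro r hr
  have h1 := pow_smul_eq_zero_of_length_le (length_stableHom_le G h) hr
    (Submodule.Quotient.mk (p := projTrivial R R M (M × G))
      (LinearMap.inl R M G))
  have h2 : r • LinearMap.inl R M G ∈ projTrivial R R M (M × G) := by
    rw [← Submodule.Quotient.mk_eq_zero]
    exact h1
  have h3 : FactorsThroughProjective R (r • LinearMap.inl R M G) := h2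
  have := h3.comp_left (LinearMap.fst R M G)
  convert this using 1
  ext x
  simp

end Length

section Lattice

open RingTheory.Sequence

lemma free_localizedModule_of_factorsThroughProjective {R : Type u} [CommRing R] {M : Type u}
    [AddCommGroup M] [Module R M] [Module.Finite R M] (p : Ideal R) [p.IsPrime] {r : R}
    (hr : r ∉ p) (h : FactorsThroughProjective R (r • (LinearMap.id : M →ₗ[R] M))) :
    Module.Free (Localization.AtPrime p) (LocalizedModule p.primeCompl M) := by
  obtain ⟨P, _, _, hP, g, h, hgh⟩ := h
  have : Module.Projective (Localization.AtPrime p) (LocalizedModule p.primeCompl P) :=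
    Module.projective_of_isLocalizedModule p.primeCompl (LocalizedModule.mkLinearMap p.primeCompl P)
  have : Module.Projective (Localization.AtPrime p) (LocalizedModule p.primeCompl M) := by
    refine Module.Projective.of_split (LocalizedModule.map p.primeCompl g)
      ((Localization.mk 1 (⟨r, hr⟩ : p.primeCompl) : Localization.AtPrime p) •
        LocalizedModule.map p.primeCompl h) ?_
    ext x
    induction x using LocalizedModule.induction_on with
    | h m s =>
      have := LinearMap.congr_fun hgh m
      simp only [LinearMap.comp_apply, LinearMap.smul_apply, LinearMap.id_apply] at this
      simp only [LinearMap.comp_apply, LinearMap.smul_apply, LocalizedModule.map_mk, this,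
        LinearMap.id_apply, LocalizedModule.mk_smul_mk, one_smul]
      rw [LocalizedModule.mk_eq]
      exact ⟨1, by simp [Submonoid.smul_def, mul_smul, smul_comm r (s : R)]⟩
  exact Module.free_of_flat_of_isLocalRing

variable (R : Type u) [CommRing R] (ys : List R) (a : ℕ)

/-- `M` is finite and `ys` is weakly regular on `M`. -/
def IsCM (M : Type u) [AddCommGroup M] [Module R M] : Prop :=
  Module.Finite R M ∧ IsWeaklyRegular M ys

variable [IsLocalRing R]

/-- A maximal regular sequence `ys`, together with a power of the maximal ideal stably annihilating
all indecomposable maximal Cohen-Macaulay modules. -/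
structure Setup : Prop where
  mem : ∀ y ∈ ys, y ∈ maximalIdeal R
  len : (ys.length : WithBot ℕ∞) = ringKrullDim R
  reg : IsWeaklyRegular R ys
  killed : ∀ (M : Type u) (_ : AddCommGroup M) (_ : Module R M), Module.Finite R M → IsMCM R M →
    IsIndecomposable R M → StablyKilled R M (maximalIdeal R ^ a)

variable {R ys a}
variable {A B C M N : Type u} [AddCommGroup A] [Module R A]
  [AddCommGroup B] [Module R B] [AddCommGroup C] [Module R C] [AddCommGroup M] [Module R M]
  [AddCommGroup N] [Module R N]

omit [IsLocalRing R] in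
lemma IsCM.of_exact {f : A →ₗ[R] B} {g : B →ₗ[R] C} (hA : IsCM R ys A) (hC : IsCM R ys C)
    (hf : Function.Injective f) (hfg : Function.Exact f g) (hg : Function.Surjective g) :
    IsCM R ys B := by
  have := hA.1
  have := hC.1
  exact ⟨Module.Finite.of_exact hfg hg, isWeaklyRegular_of_exact ys hf hfg hg hA.2 hC.2⟩

omit [IsLocalRing R] in
lemma IsCM.ker [IsNoetherianRing R] {g : B →ₗ[R] C} (hB : IsCM R ys B) (hC : IsCM R ys C)
    (hg : Function.Surjective g) : IsCM R ys (LinearMap.ker g) := by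
  have := hB.1
  exact ⟨inferInstance, isWeaklyRegular_of_exact_left ys (LinearMap.ker g).injective_subtype
    (LinearMap.exact_subtype_ker_map g) hg hB.2 hC.2⟩

omit [IsLocalRing R] in
lemma IsCM.of_retract {i : A →ₗ[R] B} {p : B →ₗ[R] A} (hB : IsCM R ys B)
    (h : p ∘ₗ i = LinearMap.id) : IsCM R ys A := by
  have := hB.1
  exact ⟨Module.Finite.of_surjective p fun x => ⟨i x, LinearMap.congr_fun h x⟩,
    isWeaklyRegular_of_retract ys h hB.2⟩

omit [IsLocalRing R] in
lemma IsCM.of_subsingleton [Subsingleton A] : IsCM R ys A :=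
  ⟨inferInstance, isWeaklyRegular_of_subsingleton ys⟩

lemma Setup.isCM_of_projective (S : Setup R ys a) [Module.Finite R A] [Module.Projective R A] :
    IsCM R ys A :=
  ⟨inferInstance, isWeaklyRegular_of_projective S.reg⟩

lemma Setup.isMCM (S : Setup R ys a) (hM : IsCM R ys M) [Nontrivial M] : IsMCM R M := by
  have := hM.1
  exact ⟨ys, S.mem, .of_isWeaklyRegular_of_mem_maximalIdeal _ S.mem hM.2, S.len⟩

lemma IsMCM.of_retract (hB : IsMCM R B) [Nontrivial A] [Module.Finite R B]
    {i : A →ₗ[R] B} {p : B →ₗ[R] A} (h : p ∘ₗ i = LinearMap.id) : IsMCM R A := by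
  have : Module.Finite R A := Module.Finite.of_surjective p fun x => ⟨i x, LinearMap.congr_fun h x⟩
  obtain ⟨rs, hm, hr, hl⟩ := hB
  exact ⟨rs, hm, .of_isWeaklyRegular_of_mem_maximalIdeal _ hm
    (isWeaklyRegular_of_retract rs h hr.1), hl⟩

variable [IsNoetherianRing R]

lemma Setup.stablyKilled_of_isMCM (S : Setup R ys a) [Module.Finite R M] (hM : IsMCM R M) :
    StablyKilled R M (maximalIdeal R ^ a) := by
  obtain ⟨l, hl, hs⟩ := exists_indecomposable_idempotents R M
  refine StablyKilled.of_idempotents hs fun f hf => ?_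
  have := (hl f hf).2.1
  exact S.killed _ _ _ inferInstance
    (hM.of_retract (rangeRestrict_comp_subtype (hl f hf).1)) (hl f hf).2

lemma Setup.isCM (S : Setup R ys a) [Module.Finite R M] (hM : IsMCM R M) : IsCM R ys M := by
  refine ⟨inferInstance, ?_⟩
  have hk := S.stablyKilled_of_isMCM hM
  obtain ⟨rs, hm, hr, hl⟩ := hM
  have := hr.nontrivial
  have hlen : rs.length = ys.length := by
    have := hl.trans S.len.symm
    exact_mod_cast this
  refine isWeaklyRegular_of_extDepth a ys S.mem (hlen ▸ extDepth_of_isRegular rs hm hr) ?_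
  intro r hr
  obtain ⟨P, _, _, hP, g, h, hgh⟩ := hk r hr
  exact ⟨P, _, _, g, h, isWeaklyRegular_of_projective S.reg, hgh⟩

lemma Setup.stablyKilled (S : Setup R ys a) (hM : IsCM R ys M) :
    StablyKilled R M (maximalIdeal R ^ a) := by
  have := hM.1
  rcases subsingleton_or_nontrivial M with h | h
  · exact .of_subsingleton _
  · exact S.stablyKilled_of_isMCM (S.isMCM hM)

lemma Setup.isLatticeC (S : Setup R ys a) (hM : IsCM R ys M) [Nontrivial M] : IsLatticeC R M := by
  have := hM.1
  refine ⟨hM.1, S.isMCM hM, fun p hp hpm => ?_⟩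
  obtain ⟨r, hr, hrp⟩ : ∃ r ∈ maximalIdeal R ^ a, r ∉ p := by
    by_contra! hcon
    exact hpm ((IsLocalRing.maximalIdeal.isMaximal R).eq_of_le hp.ne_top
      (hp.le_of_pow_le (n := a) hcon)).symm
  exact free_localizedModule_of_factorsThroughProjective p hrp (S.stablyKilled hM r hr)

lemma IsLatticeC.isCM (S : Setup R ys a) (hM : IsLatticeC R M) : IsCM R ys M := by
  have := hM.1
  exact S.isCM hM.2.1

end Lattice

section Lift

variable {R : Type u} [CommRing R]
variable {A B C M N Y : Type u} [AddCommGroup A] [Module R A]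
  [AddCommGroup B] [Module R B] [AddCommGroup C] [Module R C] [AddCommGroup M] [Module R M]
  [AddCommGroup N] [Module R N] [AddCommGroup Y] [Module R Y]

variable (R M Y) in
/-- Maps from `M` lift along surjections with kernel isomorphic to `Y`. -/
def Lifts : Prop :=
  ∀ (E C : Type u) (_ : AddCommGroup E) (_ : Module R E) (_ : AddCommGroup C) (_ : Module R C)
    (g : E →ₗ[R] C), Function.Surjective g → Nonempty (LinearMap.ker g ≃ₗ[R] Y) →
      ∀ φ : M →ₗ[R] C, ∃ ψ : M →ₗ[R] E, g ∘ₗ ψ = φ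

lemma lifts_of_ext1Vanishes (h : Ext1Vanishes R M Y) : Lifts R M Y := by
  intro E C _ _ _ _ g hg ⟨e⟩ φ
  -- the pullback of `g` along `φ`
  let P : Submodule R (M × E) := LinearMap.ker (φ.coprod (-g))
  have hP : ∀ x : M × E, x ∈ P ↔ φ x.1 = g x.2 := fun x => by
    simp [P, LinearMap.mem_ker, add_neg_eq_zero]
  let q : P →ₗ[R] M := LinearMap.fst R M E ∘ₗ P.subtype
  have hq : Function.Surjective q := fun m => by
    obtain ⟨x, hx⟩ := hg (φ m)
    exact ⟨⟨(m, x), (hP _).2 hx.symm⟩, rfl⟩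
  let j : LinearMap.ker g →ₗ[R] LinearMap.ker q :=
    LinearMap.codRestrict _ (LinearMap.codRestrict P
      (LinearMap.inr R M E ∘ₗ (LinearMap.ker g).subtype) fun x => by
        rw [hP]; simp) fun x => by simp [q]
  have hj : Function.Bijective j := by
    constructor
    · intro x y hxy
      have : ((j x : P) : M × E).2 = ((j y : P) : M × E).2 := by rw [hxy]
      exact Subtype.ext this
    · rintro ⟨⟨⟨m, x⟩, hmx⟩, hm⟩
      have hm' : m = 0 := hm
      subst hm'
      refine ⟨⟨x, ?_⟩, rfl⟩
      have := (hP _).1 hmx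
      rw [LinearMap.mem_ker]
      simpa using this.symm
  obtain ⟨s, hs⟩ := h P _ _ q hq ⟨(LinearEquiv.ofBijective j hj).symm.trans e⟩
  refine ⟨LinearMap.snd R M E ∘ₗ P.subtype ∘ₗ s, ?_⟩
  ext m
  have h1 := (hP (s m)).1 (s m).2
  have h2 : ((s m : P) : M × E).1 = m := LinearMap.congr_fun hs m
  rw [h2] at h1
  exact h1.symm

lemma Lifts.lift (h : Lifts R M Y) {E C : Type u} [AddCommGroup E] [Module R E] [AddCommGroup C]
    [Module R C] (g : E →ₗ[R] C) (hg : Function.Surjective g) (e : LinearMap.ker g ≃ₗ[R] Y)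
    (φ : M →ₗ[R] C) : ∃ ψ : M →ₗ[R] E, g ∘ₗ ψ = φ :=
  h E C _ _ _ _ g hg ⟨e⟩ φ

lemma Lifts.of_linearEquiv (h : Lifts R M Y) (e : Y ≃ₗ[R] N) : Lifts R M N := by
  intro E C _ _ _ _ g hg ⟨e'⟩ φ
  exact h.lift g hg (e'.trans e.symm) φ

/-- The modules `Y` with `Lifts R M Y` are closed under extensions. -/
lemma Lifts.of_exact {f : A →ₗ[R] B} {p : B →ₗ[R] C} (hA : Lifts R M A) (hC : Lifts R M C)
    (hf : Function.Injective f) (hfp : Function.Exact f p) (hp : Function.Surjective p) :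
    Lifts R M B := by
  intro E D _ _ _ _ g hg ⟨e⟩ φ
  let k : A →ₗ[R] E := (LinearMap.ker g).subtype ∘ₗ e.symm.toLinearMap ∘ₗ f
  have hk : Function.Injective k :=
    (LinearMap.ker g).injective_subtype.comp (e.symm.injective.comp hf)
  have hkg : LinearMap.range k ≤ LinearMap.ker g := by
    rintro _ ⟨x, rfl⟩
    exact (e.symm (f x)).2
  let q : (E ⧸ LinearMap.range k) →ₗ[R] D := (LinearMap.range k).liftQ g hkg
  have hq : Function.Surjective q := fun d => by
    obtain ⟨x, rfl⟩ := hg d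
    exact ⟨Submodule.Quotient.mk x, rfl⟩
  -- the kernel of `q` is isomorphic to `C`
  let t : B →ₗ[R] LinearMap.ker q :=
    LinearMap.codRestrict _ ((LinearMap.range k).mkQ ∘ₗ (LinearMap.ker g).subtype ∘ₗ
      e.symm.toLinearMap) fun x => (e.symm x).2
  have ht : Function.Surjective t := by
    rintro ⟨x, hx⟩
    obtain ⟨x, rfl⟩ := Submodule.Quotient.mk_surjective _ x
    have hx' : g x = 0 := hx
    refine ⟨e ⟨x, hx'⟩, Subtype.ext ?_⟩
    change Submodule.Quotient.mk ((e.symm (e ⟨x, hx'⟩) : LinearMap.ker g) : E) = _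
    rw [e.symm_apply_apply]
  have htk : LinearMap.ker t = LinearMap.ker p := by
    ext x
    rw [LinearMap.mem_ker, LinearMap.mem_ker, hfp x]
    constructor
    · intro hx
      have h1 : (Submodule.Quotient.mk (e.symm x : E) : E ⧸ LinearMap.range k) = 0 :=
        congrArg Subtype.val hx
      rw [Submodule.Quotient.mk_eq_zero] at h1
      obtain ⟨y, hy⟩ := h1
      exact ⟨y, e.symm.injective (Subtype.ext hy)⟩
    · rintro ⟨y, rfl⟩
      refine Subtype.ext ((Submodule.Quotient.mk_eq_zero _).2 ⟨y, rfl⟩)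
  let eq : LinearMap.ker q ≃ₗ[R] C :=
    (t.quotKerEquivOfSurjective ht).symm.trans ((Submodule.quotEquivOfEq _ _ htk).trans
      (p.quotKerEquivOfSurjective hp))
  obtain ⟨ψ, hψ⟩ := hC.lift q hq eq φ
  obtain ⟨χ, hχ⟩ := hA.lift (LinearMap.range k).mkQ (Submodule.mkQ_surjective _)
    ((LinearEquiv.ofEq _ _ (Submodule.ker_mkQ _)).trans (LinearEquiv.ofInjective k hk).symm) ψ
  refine ⟨χ, ?_⟩
  rw [← hψ, ← hχ]
  rfl

lemma Lifts.of_subsingleton [Subsingleton M] : Lifts R M Y := by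
  intro E C _ _ _ _ g hg _ φ
  exact ⟨0, by ext x; rw [Subsingleton.elim x 0]; simp⟩

lemma lifts_of_subsingleton_right [Subsingleton Y] : Lifts R M Y := by
  intro E C _ _ _ _ g hg ⟨e⟩ φ
  have : Subsingleton (LinearMap.ker g) := e.toEquiv.subsingleton
  have hb : Function.Bijective g :=
    ⟨LinearMap.ker_eq_bot.1 (Submodule.subsingleton_iff_eq_bot.1 this), hg⟩
  refine ⟨(LinearEquiv.ofBijective g hb).symm.toLinearMap ∘ₗ φ, ?_⟩
  ext x
  exact (LinearEquiv.ofBijective g hb).apply_symm_apply _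

end Lift

section Pushout

variable {R : Type u} [CommRing R]
variable {F L M N : Type u} [AddCommGroup F] [Module R F]
  [AddCommGroup L] [Module R L] [AddCommGroup M] [Module R M]
  [AddCommGroup N] [Module R N]

/-- The pushout of the extension `0 → ker p → F → M → 0` along `l : ker p → L`. -/
lemma exists_pushout_extension (p : F →ₗ[R] M) (hp : Function.Surjective p)
    (l : LinearMap.ker p →ₗ[R] L) :
    ∃ (E : Type u) (_ : AddCommGroup E) (_ : Module R E) (i : L →ₗ[R] E) (j : F →ₗ[R] E)
      (q : E →ₗ[R] M), Function.Injective i ∧ Function.Exact i q ∧ Function.Surjective q ∧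
      q ∘ₗ j = p ∧ (∀ x : LinearMap.ker p, j x = i (l x)) ∧ (∀ e, ∃ x y, e = j x + i y) ∧
      ∀ (N : Type u) [AddCommGroup N] [Module R N] (s : F →ₗ[R] N) (t : L →ₗ[R] N),
        (∀ x : LinearMap.ker p, s x = t (l x)) → ∃ c : E →ₗ[R] N, c ∘ₗ j = s ∧ c ∘ₗ i = t := by
  let K : Submodule R (F × L) := LinearMap.range ((LinearMap.ker p).subtype.prod (-l))
  have hKmem : ∀ z : F × L, z ∈ K ↔ ∃ x : LinearMap.ker p, (x : F) = z.1 ∧ -l x = z.2 := by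
    intro z
    constructor
    · rintro ⟨x, rfl⟩
      exact ⟨x, rfl, rfl⟩
    · rintro ⟨x, h1, h2⟩
      exact ⟨x, Prod.ext h1 h2⟩
  have hKp : K ≤ LinearMap.ker (p ∘ₗ LinearMap.fst R F L) := by
    rintro _ ⟨x, rfl⟩
    exact x.2
  have hdecomp : ∀ e : (F × L) ⧸ K, ∃ x y, e = K.mkQ (LinearMap.inl R F L x) +
      K.mkQ (LinearMap.inr R F L y) := by
    intro e
    obtain ⟨⟨x, y⟩, rfl⟩ := Submodule.Quotient.mk_surjective _ e
    refine ⟨x, y, ?_⟩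
    rw [← map_add]
    simp
  have hj : ∀ x : LinearMap.ker p, K.mkQ (LinearMap.inl R F L x) =
      K.mkQ (LinearMap.inr R F L (l x)) := by
    intro x
    rw [← sub_eq_zero, ← map_sub, Submodule.mkQ_apply, Submodule.Quotient.mk_eq_zero, hKmem]
    exact ⟨x, by simp, by simp⟩
  refine ⟨(F × L) ⧸ K, inferInstance, inferInstance, K.mkQ ∘ₗ LinearMap.inr R F L,
    K.mkQ ∘ₗ LinearMap.inl R F L, K.liftQ (p ∘ₗ LinearMap.fst R F L) hKp, ?_, ?_, ?_, ?_, hj,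
    hdecomp, ?_⟩
  · rw [injective_iff_map_eq_zero]
    intro y hy
    rw [LinearMap.comp_apply, Submodule.mkQ_apply, Submodule.Quotient.mk_eq_zero, hKmem] at hy
    obtain ⟨x, h1, h2⟩ := hy
    have : x = 0 := Subtype.ext (by simpa using h1)
    subst this
    simpa using h2.symm
  · intro e
    constructor
    · intro he
      obtain ⟨x, y, rfl⟩ := hdecomp e
      have hx : p x = 0 := by simpa using he
      refine ⟨l ⟨x, hx⟩ + y, ?_⟩
      rw [map_add, LinearMap.comp_apply, ← hj ⟨x, hx⟩]
      rfl
    · rintro ⟨y, rfl⟩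
      simp
  · intro m
    obtain ⟨x, rfl⟩ := hp m
    exact ⟨K.mkQ (x, 0), rfl⟩
  · ext x
    simp
  · intro N _ _ s t hst
    refine ⟨K.liftQ (s.coprod t) ?_, ?_, ?_⟩
    · rintro _ ⟨x, rfl⟩
      simp [hst]
    · ext x
      simp
    · ext x
      simp

/-- Maps from the kernel of `p : F → M` to `L` extend to `F` if extensions of `M` by `L` split. -/
lemma Lifts.exists_extension (h : Lifts R M L) (p : F →ₗ[R] M) (hp : Function.Surjective p)
    (l : LinearMap.ker p →ₗ[R] L) : ∃ l' : F →ₗ[R] L, ∀ x : LinearMap.ker p, l' x = l x := by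
  obtain ⟨E, _, _, i, j, q, hi, hiq, hq, hqj, hj, -, -⟩ := exists_pushout_extension p hp l
  let e := (LinearEquiv.ofInjective i hi).trans (LinearEquiv.ofEq _ _ hiq.linearMap_ker_eq.symm)
  have he : ∀ y, (e y : E) = i y := fun y => rfl
  obtain ⟨s, hs⟩ := h.lift q hq e.symm LinearMap.id
  refine ⟨e.symm.toLinearMap ∘ₗ LinearMap.codRestrict (LinearMap.ker q) (j - s ∘ₗ p) ?_, ?_⟩
  · intro x
    have h1 := LinearMap.congr_fun hs (p x)
    have h2 := LinearMap.congr_fun hqj x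
    simp only [LinearMap.comp_apply, LinearMap.id_apply] at h1 h2
    simp [LinearMap.mem_ker, h1, h2]
  · intro x
    rw [LinearMap.comp_apply, LinearEquiv.coe_coe, LinearEquiv.symm_apply_eq]
    refine Subtype.ext ?_
    rw [he, ← hj]
    have : p x = 0 := x.2
    simp [this]

end Pushout

section Approximation

variable {R : Type u} [CommRing R] {ys : List R} {a : ℕ}

lemma exists_free_cover (R : Type u) [CommRing R] (M : Type u) [AddCommGroup M] [Module R M]
    [Module.Finite R M] : ∃ (F : Type u) (_ : AddCommGroup F) (_ : Module R F) (p : F →ₗ[R] M),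
    Module.Finite R F ∧ Module.Projective R F ∧ Function.Surjective p := by
  obtain ⟨n, p, hp⟩ := Module.Finite.exists_fin' R M
  exact ⟨Fin n → R, _, _, p, inferInstance, inferInstance, hp⟩

variable (R ys) in
/-- Maps from modules in `IsCM R ys` lift along surjections with kernel `Y`. -/
def CMLifts (Y : Type u) [AddCommGroup Y] [Module R Y] : Prop :=
  ∀ (M : Type u) [AddCommGroup M] [Module R M], IsCM R ys M → Lifts R M Y

variable [IsLocalRing R] [IsNoetherianRing R]

lemma Setup.cmLifts (S : Setup R ys a) (t : ℕ) : ∀ (Y : Type u) [AddCommGroup Y] [Module R Y],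
    HasLatInjResOfLengthC R t Y → CMLifts R ys Y := by
  have base : ∀ (Y : Type u) [AddCommGroup Y] [Module R Y],
      IsLatInjectiveC R Y → CMLifts R ys Y := by
    intro Y _ _ hY M _ _ hM
    rcases subsingleton_or_nontrivial M with h | h
    · exact .of_subsingleton
    · exact lifts_of_ext1Vanishes (hY.2 M _ _ (S.isLatticeC hM))
  induction t with
  | zero => exact base
  | succ t ih =>
    rintro Y _ _ ⟨L, _, _, π, hL, hπ, hres⟩ M _ _ hM E C _ _ _ _ g hg ⟨e⟩ φ
    have := hM.1
    obtain ⟨F, _, _, p, _, _, hp⟩ := exists_free_cover R M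
    obtain ⟨θ, hθ⟩ := Module.projective_lifting_property g (φ ∘ₗ p) hg
    have hθ' : ∀ x, g (θ x) = φ (p x) := fun x => LinearMap.congr_fun hθ x
    let θ' : LinearMap.ker p →ₗ[R] LinearMap.ker g :=
      LinearMap.codRestrict _ (θ ∘ₗ (LinearMap.ker p).subtype) fun x => by
        have : p x = 0 := x.2
        simp [hθ', this]
    obtain ⟨l, hl⟩ := (ih _ hres (LinearMap.ker p) (S.isCM_of_projective.ker hM hp)).lift π hπ
      (LinearEquiv.refl _ _) (e.toLinearMap ∘ₗ θ')
    obtain ⟨l', hl'⟩ := (base L hL M hM).exists_extension p hp l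
    let χ : F →ₗ[R] E := θ - (LinearMap.ker g).subtype ∘ₗ e.symm.toLinearMap ∘ₗ π ∘ₗ l'
    have hχ : LinearMap.ker p ≤ LinearMap.ker χ := by
      intro x hx
      have h1 := LinearMap.congr_fun hl ⟨x, hx⟩
      have h2 := hl' ⟨x, hx⟩
      simp only [LinearMap.comp_apply, LinearEquiv.coe_coe] at h1 h2
      rw [LinearMap.mem_ker]
      simp only [χ, LinearMap.sub_apply, LinearMap.comp_apply, LinearEquiv.coe_coe, h2, h1,
        LinearEquiv.symm_apply_apply]
      exact sub_self (θ x)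
    refine ⟨(LinearMap.ker p).liftQ χ hχ ∘ₗ (p.quotKerEquivOfSurjective hp).symm.toLinearMap, ?_⟩
    ext m
    obtain ⟨x, rfl⟩ := hp m
    have h3 : (p.quotKerEquivOfSurjective hp).symm (p x) = Submodule.Quotient.mk x := by
      rw [LinearEquiv.symm_apply_eq]
      rfl
    simp only [LinearMap.comp_apply, LinearEquiv.coe_coe, h3, Submodule.liftQ_apply]
    simp [χ, hθ']

variable (R ys) in
/-- `N` admits a surjection from a module in `IsCM R ys`, along which all maps from modules in
`IsCM R ys` lift. -/
def HasApprox (N : Type u) [AddCommGroup N] [Module R N] : Prop :=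
  ∃ (V : Type u) (_ : AddCommGroup V) (_ : Module R V) (p : V →ₗ[R] N), IsCM R ys V ∧
    Function.Surjective p ∧ CMLifts R ys (LinearMap.ker p)

omit [IsLocalRing R] [IsNoetherianRing R] in
lemma HasApprox.of_linearEquiv {N N' : Type u} [AddCommGroup N] [Module R N] [AddCommGroup N']
    [Module R N'] (h : HasApprox R ys N) (e : N ≃ₗ[R] N') : HasApprox R ys N' := by
  obtain ⟨V, _, _, p, hV, hp, hL⟩ := h
  refine ⟨V, _, _, e.toLinearMap ∘ₗ p, hV, e.surjective.comp hp, fun M _ _ hM => ?_⟩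
  exact (hL M hM).of_linearEquiv (LinearEquiv.ofEq _ _ (by simp [LinearMap.ker_comp]))

lemma Setup.hasApprox_of_submodule (S : Setup R ys a) {N : Type u} [AddCommGroup N] [Module R N]
    (N' : Submodule R N) (h' : HasApprox R ys N') (hq : HasApprox R ys (N ⧸ N')) :
    HasApprox R ys N := by
  obtain ⟨V, _, _, p, hV, hp, hpL⟩ := h'
  obtain ⟨W, _, _, α, hW, hα, hαL⟩ := hq
  have := hW.1
  obtain ⟨F, _, _, w, _, _, hw⟩ := exists_free_cover R W
  obtain ⟨θ, hθ⟩ := Module.projective_lifting_property N'.mkQ (α ∘ₗ w) N'.mkQ_surjective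
  have hθ' : ∀ x, (Submodule.Quotient.mk (θ x) : N ⧸ N') = α (w x) :=
    fun x => LinearMap.congr_fun hθ x
  let θ' : LinearMap.ker w →ₗ[R] N' :=
    LinearMap.codRestrict _ (θ ∘ₗ (LinearMap.ker w).subtype) fun x => by
      have : w x = 0 := x.2
      rw [← Submodule.Quotient.mk_eq_zero]
      simp [hθ', this]
  obtain ⟨l, hl⟩ := (hpL (LinearMap.ker w) (S.isCM_of_projective.ker hW hw)).lift p hp
    (LinearEquiv.refl _ _) θ'
  have hl' : ∀ x : LinearMap.ker w, (p (l x) : N) = θ x := fun x =>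
    congrArg Subtype.val (LinearMap.congr_fun hl x)
  obtain ⟨X, _, _, i, j, q, hi, hiq, hq, hqj, hj, hd, hu⟩ := exists_pushout_extension w hw l
  obtain ⟨c, hcj, hci⟩ := hu N θ (N'.subtype ∘ₗ p) fun x => (hl' x).symm
  have hcj' : ∀ x, c (j x) = θ x := fun x => LinearMap.congr_fun hcj x
  have hci' : ∀ x, c (i x) = p x := fun x => LinearMap.congr_fun hci x
  have hqj' : ∀ x, q (j x) = w x := fun x => LinearMap.congr_fun hqj x
  have hαq : ∀ x, α (q x) = Submodule.Quotient.mk (c x) := by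
    intro e
    obtain ⟨x, y, rfl⟩ := hd e
    rw [map_add, map_add, map_add, hcj', hci', hqj', hiq.apply_apply_eq_zero, Submodule.Quotient.mk_add,
      (Submodule.Quotient.mk_eq_zero N').2 (p y).2, hθ', map_zero]
  refine ⟨X, _, _, c, hV.of_exact hW hi hiq hq, ?_, fun M _ _ hM => ?_⟩
  · intro n
    obtain ⟨y, hy⟩ := hα (Submodule.Quotient.mk n)
    obtain ⟨x, rfl⟩ := hw y
    rw [← hθ', Submodule.Quotient.eq] at hy
    obtain ⟨v, hv⟩ := hp ⟨_, hy⟩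
    refine ⟨j x - i v, ?_⟩
    rw [map_sub, hcj', hci', hv]
    simp
  · let f : LinearMap.ker p →ₗ[R] LinearMap.ker c :=
      LinearMap.codRestrict _ (i ∘ₗ (LinearMap.ker p).subtype) fun x => by
        have : p x = 0 := x.2
        simp [hci', this]
    let g : LinearMap.ker c →ₗ[R] LinearMap.ker α :=
      LinearMap.codRestrict _ (q ∘ₗ (LinearMap.ker c).subtype) fun x => by
        have : c x = 0 := x.2
        simp [hαq, this]
    refine (hpL M hM).of_exact (f := f) (p := g) (hαL M hM) ?_ ?_ ?_
    · intro x y hxy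
      exact Subtype.ext (hi (congrArg Subtype.val hxy))
    · intro x
      constructor
      · intro hx
        have hx' : q x = 0 := congrArg Subtype.val hx
        obtain ⟨y, hy⟩ := (hiq _).1 hx'
        have hcx : c x = 0 := x.2
        rw [← hy, hci'] at hcx
        exact ⟨⟨y, Subtype.ext hcx⟩, Subtype.ext hy⟩
      · rintro ⟨y, rfl⟩
        exact Subtype.ext (hiq.apply_apply_eq_zero _)
    · rintro ⟨y, hy⟩
      obtain ⟨x, rfl⟩ := hw y
      have hx : θ x ∈ N' := by
        rw [← Submodule.Quotient.mk_eq_zero, hθ']; exact hy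
      obtain ⟨v, hv⟩ := hp ⟨_, hx⟩
      refine ⟨⟨j x - i v, ?_⟩, Subtype.ext ?_⟩
      · rw [LinearMap.mem_ker, map_sub, hcj', hci', hv]
        simp
      · change q (j x - i v) = w x
        rw [map_sub, hqj', hiq.apply_apply_eq_zero, sub_zero]

lemma Setup.hasApprox (S : Setup R ys a) (hk : HasApprox R ys (ResidueField R))
    {N : Type u} [AddCommGroup N] [Module R N] (hN : IsFiniteLength R N) : HasApprox R ys N := by
  have main : ∀ (n : ℕ) (N : Type u) [AddCommGroup N] [Module R N], IsFiniteLength R N →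
      Module.length R N = n → HasApprox R ys N := by
    intro n
    induction n with
    | zero =>
      intro N _ _ _ h
      have : Subsingleton N := Module.length_eq_zero_iff.1 (by simpa using h)
      exact ⟨N, _, _, LinearMap.id, .of_subsingleton, Function.surjective_id,
        fun M _ _ _ => lifts_of_subsingleton_right⟩
    | succ n ih =>
      intro N _ _ hN h
      cases hN with
      | of_subsingleton =>
        rw [Module.length_eq_zero_iff.2 inferInstance] at h
        exact absurd h (by exact_mod_cast (Nat.succ_ne_zero n).symm)
      | @of_simple_quotient _ _ _ N' hs hN' =>
        have hadd := Module.length_eq_add_of_exact N'.subtype N'.mkQ N'.injective_subtype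
          N'.mkQ_surjective (LinearMap.exact_subtype_mkQ N')
        rw [h, Module.length_eq_one R (N ⧸ N')] at hadd
        refine S.hasApprox_of_submodule N' (ih _ hN' ?_) ?_
        · have : (n : ℕ∞) + 1 = Module.length R N' + 1 := by exact_mod_cast hadd
          exact (ENat.add_left_injective_of_ne_top ENat.one_ne_top this).symm
        · obtain ⟨I, hI, ⟨e⟩⟩ := isSimpleModule_iff_quot_maximal.1 hs
          rw [IsLocalRing.eq_maximalIdeal hI] at e
          exact hk.of_linearEquiv e.symm
  obtain ⟨n, hn⟩ := ENat.ne_top_iff_exists.1 (Module.length_ne_top_iff.2 hN)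
  exact main n N hN hn.symm

lemma Setup.hasApprox_residueField (S : Setup R ys a) {G : Type u} [AddCommGroup G] [Module R G]
    {α : G →ₗ[R] ResidueField R} (hG : IsResidueApprox R G α) : HasApprox R ys (ResidueField R) := by
  obtain ⟨t, ht⟩ := hG.2.2.1
  exact ⟨G, _, _, α, hG.1.isCM S, hG.2.1, S.cmLifts t _ ht⟩

end Approximation

section Generators

open scoped TensorProduct

variable {R : Type u} [CommRing R] [IsLocalRing R]
variable {M G : Type u} [AddCommGroup M] [Module R M] [AddCommGroup G] [Module R G]

/-- A module with at most `n`-dimensional dual into the residue field has at most `n` generators. -/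
lemma exists_surjective_pi_of_length_dual_le [Module.Finite R M] {b : ℕ}
    (h : Module.length R (M →ₗ[R] ResidueField R) ≤ b) :
    ∃ n ≤ b, ∃ p : (Fin n → R) →ₗ[R] M, Function.Surjective p := by
  let B := Module.finBasis (ResidueField R) (ResidueField R ⊗[R] M)
  have hs := TensorProduct.mk_surjective R M (ResidueField R) residue_surjective
  choose f hf using fun i => hs (B i)
  have hspan := span_eq_top_of_tmul_eq_basis f B hf
  refine ⟨_, ?_, Fintype.linearCombination R f, ?_⟩
  · let Φ : (Fin (Module.finrank (ResidueField R) (ResidueField R ⊗[R] M)) → ResidueField R) →ₗ[R]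
        (M →ₗ[R] ResidueField R) :=
      { toFun := fun c => ∑ i, c i • ((B.coord i).restrictScalars R ∘ₗ
          TensorProduct.mk R (ResidueField R) M 1)
        map_add' := fun c d => by simp [add_smul, Finset.sum_add_distrib]
        map_smul' := fun r c => by simp [Finset.smul_sum, smul_assoc] }
    have hΦ : Function.Injective Φ := by
      rw [injective_iff_map_eq_zero]
      intro c hc
      ext j
      have := LinearMap.congr_fun hc (f j)
      have h2 : ∀ j, (1 : ResidueField R) ⊗ₜ[R] f j = B j := hf
      simpa [Φ, LinearMap.sum_apply, h2, Finsupp.single_apply] using this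
    have h1 := (Module.length_le_of_injective Φ hΦ).trans h
    rw [Module.length_pi] at h1
    have h2 : 1 ≤ Module.length R (ResidueField R) :=
      Order.one_le_iff_ne_zero.2 (mt Module.length_eq_zero_iff.1 (not_subsingleton _))
    have h3 := (mul_le_mul_right h2 _).trans h1
    rw [mul_one] at h3
    simpa using h3
  · rw [← LinearMap.range_eq_top, Fintype.range_linearCombination, hspan]

/-- An indecomposable module admitting a nonzero map to the residue field which factors through a
projective module is cyclic. -/
lemma IsIndecomposable.exists_surjective_of_factorsThroughProjective (hM : IsIndecomposable R M)
    {f : M →ₗ[R] ResidueField R} (hf : FactorsThroughProjective R f) (h0 : f ≠ 0) :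
    ∃ p : (Fin 1 → R) →ₗ[R] M, Function.Surjective p := by
  obtain ⟨P, _, _, _, g, h, rfl⟩ := hf
  obtain ⟨h', hh'⟩ := Module.projective_lifting_property (Algebra.linearMap R (ResidueField R)) h
    residue_surjective
  obtain ⟨m, hm⟩ : ∃ m, h (g m) ≠ 0 := by
    by_contra! hcon
    exact h0 (LinearMap.ext hcon)
  have hu : IsUnit (h' (g m)) := by
    have : residue R (h' (g m)) ≠ 0 := by
      rw [← hh'] at hm
      exact hm
    rwa [residue_ne_zero_iff_isUnit] at this
  obtain ⟨u, hu⟩ := hu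
  have hs : (h' ∘ₗ g) ∘ₗ LinearMap.toSpanSingleton R M ((↑u⁻¹ : R) • m) = LinearMap.id := by
    ext
    simp [← hu]
  exact ⟨LinearMap.toSpanSingleton R M ((↑u⁻¹ : R) • m) ∘ₗ LinearMap.proj 0,
    (hM.bijective_of_leftInverse hs).2.comp (LinearMap.proj_surjective 0)⟩

lemma exists_surjective_pi {ys : List R} {b : ℕ} (hb : 0 < b) (hM : IsCM R ys M)
    (hMi : IsIndecomposable R M) {α : G →ₗ[R] ResidueField R} (hα : Function.Surjective α)
    (hL : CMLifts R ys (LinearMap.ker α)) (h : Module.length R (stableHom R R M (M × G)) ≤ b) :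
    ∃ n ≤ b, ∃ p : (Fin n → R) →ₗ[R] M, Function.Surjective p := by
  have := hM.1
  by_cases hex : ∃ f : M →ₗ[R] ResidueField R, FactorsThroughProjective R f ∧ f ≠ 0
  · obtain ⟨f, hf, h0⟩ := hex
    exact ⟨1, hb, hMi.exists_surjective_of_factorsThroughProjective hf h0⟩
  · push Not at hex
    let Ψ : (M →ₗ[R] M × G) →ₗ[R] (M →ₗ[R] ResidueField R) :=
      (α ∘ₗ LinearMap.snd R M G).compRight R
    have hΨ : projTrivial R R M (M × G) ≤ LinearMap.ker Ψ := fun f hf =>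
      hex _ (FactorsThroughProjective.comp_left hf (α ∘ₗ LinearMap.snd R M G))
    let Φ : stableHom R R M (M × G) →ₗ[R] (M →ₗ[R] ResidueField R) :=
      (projTrivial R R M (M × G)).liftQ Ψ hΨ
    refine exists_surjective_pi_of_length_dual_le
      ((Module.length_le_of_surjective Φ fun φ => ?_).trans h)
    obtain ⟨ψ, hψ⟩ := (hL M hM).lift α hα (LinearEquiv.refl _ _) φ
    exact ⟨Submodule.Quotient.mk (LinearMap.inr R M G ∘ₗ ψ), hψ⟩

omit [IsLocalRing R] in
lemma length_quotient_smul_top_le (J : Ideal R) {n b : ℕ} (hn : n ≤ b)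
    {p : (Fin n → R) →ₗ[R] M} (hp : Function.Surjective p) :
    Module.length R (M ⧸ J • (⊤ : Submodule R M)) ≤ b * Module.length R (R ⧸ J) := by
  let q : (Fin n → R ⧸ J) →ₗ[R] (M ⧸ J • (⊤ : Submodule R M)) :=
    ∑ i, (Submodule.liftQ J ((J • (⊤ : Submodule R M)).mkQ ∘ₗ p ∘ₗ LinearMap.single R (fun _ : Fin n => R) i)
      (fun r hr => by
        have : p (Pi.single i r) = r • p (Pi.single i 1) := by
          rw [← map_smul, ← Pi.single_smul, smul_eq_mul, mul_one]
        rw [LinearMap.mem_ker]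
        simp only [LinearMap.comp_apply, LinearMap.coe_single, this, Submodule.mkQ_apply]
        rw [Submodule.Quotient.mk_eq_zero]
        exact Submodule.smul_mem_smul hr Submodule.mem_top)) ∘ₗ LinearMap.proj i
  have hq : Function.Surjective q := fun x => by
    obtain ⟨x, rfl⟩ := Submodule.Quotient.mk_surjective _ x
    obtain ⟨v, rfl⟩ := hp x
    refine ⟨fun i => Submodule.Quotient.mk (v i), ?_⟩
    simp only [q, LinearMap.sum_apply, LinearMap.comp_apply, LinearMap.proj_apply,
      Submodule.liftQ_apply, LinearMap.coe_single]
    rw [← map_sum, ← map_sum, Finset.univ_sum_single]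
    rfl
  refine (Module.length_le_of_surjective q hq).trans ?_
  rw [Module.length_pi]
  gcongr
  simpa using hn

end Generators

section LiftModulo

open RingTheory.Sequence Pointwise

variable {R : Type u} [CommRing R] {X N : Type u} [AddCommGroup X] [Module R X]
  [AddCommGroup N] [Module R N]

lemma exists_lift_modulo_smul {y : R} (hy : IsSMulRegular N y)
    (hX : FactorsThroughProjective R (y • (LinearMap.id : X →ₗ[R] X)))
    (φ : X →ₗ[R] QuotSMulTop (y ^ 2) N) :
    ∃ ψ : X →ₗ[R] N, ∀ x n, Submodule.Quotient.mk n = φ x → ψ x - n ∈ y • (⊤ : Submodule R N) := by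
  obtain ⟨P, _, _, _, g, h, hgh⟩ := hX
  obtain ⟨θ, hθ⟩ := Module.projective_lifting_property (Submodule.mkQ _) (φ ∘ₗ h)
    (Submodule.mkQ_surjective ((y ^ 2) • (⊤ : Submodule R N)))
  have key : ∀ x n, Submodule.Quotient.mk n = φ x → ∃ n', θ (g x) = y • (n + y • n') := by
    intro x n hn
    have h1 : (Submodule.Quotient.mk (θ (g x)) : QuotSMulTop (y ^ 2) N) =
        Submodule.Quotient.mk (y • n) := by
      refine (LinearMap.congr_fun hθ (g x)).trans ?_
      have h2 : h (g x) = y • x := LinearMap.congr_fun hgh x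
      rw [LinearMap.comp_apply, h2, map_smul, ← hn, Submodule.Quotient.mk_smul]
    rw [Submodule.Quotient.eq] at h1
    obtain ⟨n', -, hn'⟩ := h1
    refine ⟨n', ?_⟩
    have hn'' : (y ^ 2) • n' = θ (g x) - y • n := hn'
    rw [smul_add, smul_smul, ← pow_two, hn'']
    abel
  have hinj : Function.Injective (LinearMap.lsmul R N y) := hy
  let χ : X →ₗ[R] LinearMap.range (LinearMap.lsmul R N y) :=
    LinearMap.codRestrict _ (θ ∘ₗ g) fun x => by
      obtain ⟨n, hn⟩ := Submodule.Quotient.mk_surjective _ (φ x)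
      obtain ⟨n', hn'⟩ := key x n hn
      exact ⟨_, hn'.symm⟩
  let e := LinearEquiv.ofInjective _ hinj
  refine ⟨e.symm.toLinearMap ∘ₗ χ, fun x n hn => ?_⟩
  obtain ⟨n', hn'⟩ := key x n hn
  have h1 : e.symm (χ x) = n + y • n' := by
    rw [LinearEquiv.symm_apply_eq]
    exact Subtype.ext hn'
  rw [LinearMap.comp_apply, LinearEquiv.coe_coe, h1, add_sub_cancel_left]
  exact Submodule.smul_mem_pointwise_smul _ _ _ Submodule.mem_top

lemma exists_lift_modulo_ofList (xs : List R) : ∀ (N : Type u) [AddCommGroup N] [Module R N]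
    {Q : Type u} [AddCommGroup Q] [Module R Q] (π : N →ₗ[R] Q) (_ : Function.Surjective π)
    (_ : LinearMap.ker π = Ideal.ofList (xs.map (· ^ 2)) • (⊤ : Submodule R N))
    (_ : IsWeaklyRegular N (xs.map (· ^ 2)))
    (_ : ∀ x ∈ xs, FactorsThroughProjective R (x • (LinearMap.id : X →ₗ[R] X)))
    (φ : X →ₗ[R] Q), ∃ ψ : X →ₗ[R] N, ∀ x n, π n = φ x →
      ψ x - n ∈ Ideal.ofList xs • (⊤ : Submodule R N) := by
  induction xs with
  | nil =>
    intro N _ _ Q _ _ π hπ hk _ _ φ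
    have hb : Function.Bijective π := ⟨LinearMap.ker_eq_bot.1 (by simpa using hk), hπ⟩
    let e := LinearEquiv.ofBijective π hb
    refine ⟨e.symm.toLinearMap ∘ₗ φ, fun x n hn => ?_⟩
    have : e.symm (φ x) = n := by
      rw [LinearEquiv.symm_apply_eq]; exact hn.symm
    simp [this]
  | cons y xs ih =>
    intro N _ _ Q _ _ π hπ hk hreg hX φ
    rw [List.map_cons, isWeaklyRegular_cons_iff] at hreg
    rw [List.map_cons, Ideal.ofList_cons_smul] at hk
    have hle : (y ^ 2) • (⊤ : Submodule R N) ≤ LinearMap.ker π := hk ▸ le_sup_left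
    let π' : QuotSMulTop (y ^ 2) N →ₗ[R] Q := Submodule.liftQ _ π hle
    have hπ' : Function.Surjective π' := fun q => by
      obtain ⟨n, rfl⟩ := hπ q
      exact ⟨Submodule.Quotient.mk n, rfl⟩
    have hk' : LinearMap.ker π' = Ideal.ofList (xs.map (· ^ 2)) • ⊤ := by
      rw [Submodule.ker_liftQ, hk, Submodule.map_sup, Submodule.map_smul'', Submodule.map_top,
        Submodule.range_mkQ, Submodule.mkQ_map_self, bot_sup_eq]
    obtain ⟨ψ', hψ'⟩ := ih _ π' hπ' hk' hreg.2 (fun x hx => hX x (List.mem_cons_of_mem _ hx)) φ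
    have hy : IsSMulRegular N y := IsSMulRegular.of_mul (a := y) (by rw [← pow_two]; exact hreg.1)
    obtain ⟨ψ, hψ⟩ := exists_lift_modulo_smul hy (hX y List.mem_cons_self) ψ'
    refine ⟨ψ, fun x n hn => ?_⟩
    obtain ⟨m, hm⟩ := Submodule.Quotient.mk_surjective _ (ψ' x)
    have h1 := hψ x m hm
    have h2 := hψ' x (Submodule.Quotient.mk n) hn
    rw [← hm, ← Submodule.Quotient.mk_sub] at h2
    have h3 : m - n ∈ (y ^ 2) • (⊤ : Submodule R N) ⊔ Ideal.ofList xs • ⊤ := by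
      have : m - n ∈ Submodule.comap (Submodule.mkQ ((y ^ 2) • (⊤ : Submodule R N)))
        (Submodule.map (Submodule.mkQ ((y ^ 2) • (⊤ : Submodule R N)))
          (Ideal.ofList xs • (⊤ : Submodule R N))) := by
        rw [Submodule.map_smul'', Submodule.map_top, Submodule.range_mkQ]
        exact h2
      rwa [Submodule.comap_map_eq, Submodule.ker_mkQ, sup_comm] at this
    have h4 : (y ^ 2) • (⊤ : Submodule R N) ≤ y • ⊤ := by
      rintro _ ⟨z, -, rfl⟩
      refine ⟨y • z, trivial, ?_⟩
      simp [pow_two, mul_smul]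
    rw [Ideal.ofList_cons_smul, ← sub_add_sub_cancel _ m n]
    exact add_mem (Submodule.mem_sup_left h1) (sup_le_sup_right h4 _ h3)

end LiftModulo

section Idempotent

variable {R : Type u} [CommRing R] {X : Type u} [AddCommGroup X] [Module R X]

lemma isAdicComplete_of_finite [IsLocalRing R] [IsNoetherianRing R]
    [IsAdicComplete (maximalIdeal R) R] [Module.Finite R X] :
    IsAdicComplete (maximalIdeal R) X := by
  refine AdicCompletion.of_bijective_iff.1 ⟨AdicCompletion.of_injective _ _, fun z => ?_⟩
  obtain ⟨t, rfl⟩ := AdicCompletion.ofTensorProduct_surjective_of_finite (maximalIdeal R) X z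
  induction t with
  | zero => exact ⟨0, by simp⟩
  | tmul r x =>
    obtain ⟨r, rfl⟩ := AdicCompletion.of_surjective (maximalIdeal R) R r
    refine ⟨r • x, ?_⟩
    rw [AdicCompletion.ofTensorProduct_tmul, map_smul]
    ext n
    rfl
  | add s t hs ht =>
    obtain ⟨x, hx⟩ := hs
    obtain ⟨y, hy⟩ := ht
    exact ⟨x + y, by rw [map_add, map_add, hx, hy]⟩

open Submodule in
/-- Idempotents modulo `I` lift to idempotents. -/
lemma exists_idempotent_of_isAdicComplete (I : Ideal R) [IsAdicComplete I X] (f : X →ₗ[R] X)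
    (hf : ∀ x, f (f x) - f x ∈ I • (⊤ : Submodule R X)) :
    ∃ ε : X →ₗ[R] X, ε ∘ₗ ε = ε ∧ ∀ x, ε x - f x ∈ I • (⊤ : Submodule R X) := by
  have smul_mem : ∀ (g : X →ₗ[R] X) (J : Ideal R) (x : X), x ∈ J • (⊤ : Submodule R X) →
      g x ∈ J • (⊤ : Submodule R X) := fun g J x hx => by
    have := Submodule.mem_map_of_mem (f := g) hx
    rw [Submodule.map_smul''] at this
    exact Submodule.smul_mono le_rfl le_top this
  let e : ℕ → Module.End R X := fun n => Nat.rec f (fun _ e => 3 * e ^ 2 - 2 * e ^ 3) n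
  have e_succ : ∀ n, e (n + 1) = 3 * e n ^ 2 - 2 * e n ^ 3 := fun n => rfl
  have hcomm : ∀ n, ∃ g : Module.End R X, e (n + 1) - e n = g * (e n * e n - e n) :=
    fun n => ⟨1 - 2 * e n, by rw [e_succ]; noncomm_ring⟩
  have hidem : ∀ n, ∃ g : Module.End R X, e (n + 1) * e (n + 1) - e (n + 1) =
      g * ((e n * e n - e n) * (e n * e n - e n)) :=
    fun n => ⟨4 * e n ^ 2 - 4 * e n - 3, by rw [e_succ]; noncomm_ring⟩
  have hpow : ∀ n x, (e n * e n - e n) x ∈ I ^ (n + 1) • (⊤ : Submodule R X) := by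
    intro n
    induction n with
    | zero => intro x; rw [zero_add, pow_one]; exact hf x
    | succ n ih =>
      intro x
      obtain ⟨g, hg⟩ := hidem n
      rw [hg]
      refine smul_mem g _ _ ?_
      set d := e n * e n - e n
      have h1 : LinearMap.range d ≤ I ^ (n + 1) • (⊤ : Submodule R X) := by
        rintro _ ⟨y, rfl⟩; exact ih y
      have h2 : d (d x) ∈ Submodule.map d (I ^ (n + 1) • (⊤ : Submodule R X)) :=
        Submodule.mem_map_of_mem (ih x)
      rw [Submodule.map_smul'', Submodule.map_top] at h2
      have h3 := Submodule.smul_mono (le_refl (I ^ (n + 1))) h1 h2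
      rw [← mul_smul, ← pow_add] at h3
      exact Submodule.smul_mono_left (Ideal.pow_le_pow_right (by omega)) h3
  have hcau : ∀ n x, (e (n + 1)) x - e n x ∈ I ^ (n + 1) • (⊤ : Submodule R X) := by
    intro n x
    obtain ⟨g, hg⟩ := hcomm n
    rw [← LinearMap.sub_apply, hg]
    exact smul_mem g _ _ (hpow n x)
  have hcau' : ∀ m n, m ≤ n → ∀ x, e n x - e m x ∈ I ^ (m + 1) • (⊤ : Submodule R X) := by
    intro m n hmn x
    induction n, hmn using Nat.le_induction with
    | base => simp
    | succ n hmn ih =>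
      rw [← sub_add_sub_cancel _ (e n x)]
      exact add_mem (Submodule.smul_mono_left (Ideal.pow_le_pow_right (by omega)) (hcau n x)) ih
  have hle : ∀ n, I ^ (n + 1) • (⊤ : Submodule R X) ≤ I ^ n • ⊤ := fun n =>
    Submodule.smul_mono_left (Ideal.pow_le_pow_right (by omega))
  have hlim : ∀ x, ∃ L, ∀ n, e n x ≡ L [SMOD (I ^ n • ⊤ : Submodule R X)] := fun x =>
    IsPrecomplete.prec inferInstance fun {m n} hmn => by
      refine (SModEq.sub_mem.2 (hle m (hcau' m n hmn x))).symm
  choose L hL using hlim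
  have hL' : ∀ n x, L x - e n x ∈ (I ^ n • ⊤ : Submodule R X) := fun n x =>
    SModEq.sub_mem.1 (hL x n).symm
  have haus : ∀ x : X, (∀ n, x ∈ (I ^ n • ⊤ : Submodule R X)) → x = 0 := fun x hx =>
    IsHausdorff.haus (I := I) inferInstance x fun n => SModEq.zero.2 (hx n)
  let ε : X →ₗ[R] X :=
    { toFun := L
      map_add' := fun x y => by
        rw [← sub_eq_zero]
        refine haus _ fun n => ?_
        have := sub_mem (sub_mem (hL' n (x + y)) (hL' n x)) (hL' n y)
        rw [map_add] at this
        convert this using 1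
        abel
      map_smul' := fun r x => by
        rw [← sub_eq_zero]
        refine haus _ fun n => ?_
        have := sub_mem (hL' n (r • x)) (Submodule.smul_mem _ r (hL' n x))
        rw [map_smul] at this
        convert this using 1
        rw [smul_sub, RingHom.id_apply]
        abel }
  have hε : ∀ n x, ε x - e n x ∈ (I ^ n • ⊤ : Submodule R X) := hL'
  refine ⟨ε, ?_, fun x => ?_⟩
  · ext x
    rw [← sub_eq_zero]
    refine haus _ fun n => ?_
    have h1 := hε n (ε x)
    have h2 := smul_mem (e n) _ _ (hε n x)
    have h3 := hle _ (hpow n x)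
    have h4 := hε n x
    rw [map_sub] at h2
    have := sub_mem (add_mem (add_mem h1 h2) h3) h4
    convert this using 1
    simp only [LinearMap.comp_apply, LinearMap.sub_apply, Module.End.mul_apply]
    abel
  · have h1 := hε 1 x
    have h2 := hcau 0 x
    rw [pow_one] at h1
    rw [zero_add, pow_one] at h2
    have := add_mem h1 h2
    rwa [sub_add_sub_cancel] at this

end Idempotent

section Reduction

variable {R : Type u} [CommRing R] (J : Ideal R)

variable (R) in
/-- The reduction `M / J M`. -/
abbrev Red (M : Type u) [AddCommGroup M] [Module R M] : Type u := M ⧸ (J • ⊤ : Submodule R M)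

variable {L M N X : Type u} [AddCommGroup L] [Module R L] [AddCommGroup M] [Module R M]
  [AddCommGroup N] [Module R N] [AddCommGroup X] [Module R X]

/-- The map induced on reductions. -/
def redMap (f : M →ₗ[R] N) : Red R J M →ₗ[R] Red R J N :=
  Submodule.mapQ _ _ f (Submodule.smul_top_le_comap_smul_top J f)

lemma redMap_mk (f : M →ₗ[R] N) (x : M) :
    redMap J f (Submodule.Quotient.mk x) = Submodule.Quotient.mk (f x) := rfl

lemma redMap_comp (g : M →ₗ[R] N) (f : L →ₗ[R] M) :
    redMap J (g ∘ₗ f) = redMap J g ∘ₗ redMap J f := by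
  ext; rfl

lemma smul_red_eq_zero {r : R} (hr : r ∈ J) (x : Red R J M) : r • x = 0 := by
  obtain ⟨x, rfl⟩ := Submodule.Quotient.mk_surjective _ x
  rw [← Submodule.Quotient.mk_smul, Submodule.Quotient.mk_eq_zero]
  exact Submodule.smul_mem_smul hr Submodule.mem_top

variable (R M N) in
/-- Maps `M → N / J N` lift, modulo `I`, to maps `M → N`. -/
def LiftsModulo (I : Ideal R) : Prop :=
  ∀ φ : M →ₗ[R] Red R J N, ∃ ψ : M →ₗ[R] N, ∀ x n, Submodule.Quotient.mk n = φ x →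
    ψ x - n ∈ I • (⊤ : Submodule R N)

variable {J} in
lemma mem_smul_top_apply (f : M →ₗ[R] N) {x : M} (hx : x ∈ J • (⊤ : Submodule R M)) :
    f x ∈ J • (⊤ : Submodule R N) :=
  Submodule.smul_top_le_comap_smul_top J f hx

variable [IsLocalRing R]

lemma eq_zero_of_idempotent_of_mem [Module.Finite R M] {e : M →ₗ[R] M} (he : e ∘ₗ e = e)
    (h : ∀ x, e x ∈ maximalIdeal R • (⊤ : Submodule R M)) : e = 0 := by
  rw [← LinearMap.range_eq_bot]
  refine Submodule.eq_bot_of_le_smul_of_le_jacobson_bot (maximalIdeal R) _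
    (Module.Finite.iff_fg.1 (Module.Finite.range e)) ?_ (maximalIdeal_le_jacobson _)
  rintro _ ⟨x, rfl⟩
  have := Submodule.mem_map_of_mem (f := e) (h x)
  rwa [Submodule.map_smul'', Submodule.map_top, ← LinearMap.comp_apply, he] at this

lemma bijective_of_sub_mem [Module.Finite R M] {f : M →ₗ[R] M}
    (h : ∀ x, f x - x ∈ maximalIdeal R • (⊤ : Submodule R M)) : Function.Bijective f := by
  have hs : Function.Surjective f := by
    rw [← LinearMap.range_eq_top, eq_top_iff]
    refine Submodule.le_of_le_smul_of_le_jacobson_bot Module.Finite.fg_top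
      (maximalIdeal_le_jacobson _) fun x _ => ?_
    rw [← sub_sub_cancel (f x) x]
    exact sub_mem (Submodule.mem_sup_left ⟨x, rfl⟩) (Submodule.mem_sup_right (h x))
  exact ⟨OrzechProperty.injective_of_surjective_endomorphism f hs, hs⟩

variable {J} (hJ : J ≤ maximalIdeal R)
include hJ

lemma nontrivial_red [Module.Finite R M] [Nontrivial M] : Nontrivial (Red R J M) :=
  Submodule.Quotient.nontrivial_iff.2
    ((Submodule.smul_mono_left hJ).trans_lt maximalIdeal_smul_lt_top).ne

lemma mk_mem_smul_top_iff (x : M) :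
    (Submodule.Quotient.mk x : Red R J M) ∈ maximalIdeal R • (⊤ : Submodule R (Red R J M)) ↔
      x ∈ maximalIdeal R • (⊤ : Submodule R M) := by
  have : maximalIdeal R • (⊤ : Submodule R (Red R J M)) =
      (maximalIdeal R • (⊤ : Submodule R M)).map (Submodule.mkQ _) := by
    rw [Submodule.map_smul'', Submodule.map_top, Submodule.range_mkQ]
  rw [this, ← Submodule.mkQ_apply, ← Submodule.mem_comap, Submodule.comap_map_eq,
    Submodule.ker_mkQ, sup_eq_left.2 (Submodule.smul_mono_left hJ)]

lemma isIndecomposable_red [IsNoetherianRing R] [IsAdicComplete (maximalIdeal R) R]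
    [Module.Finite R M] (hM : IsIndecomposable R M) (hL : LiftsModulo R J M M (maximalIdeal R)) :
    IsIndecomposable R (Red R J M) := by
  have := hM.1
  have := nontrivial_red (M := M) hJ
  have := isAdicComplete_of_finite (R := R) (X := M)
  refine isIndecomposable_of_idempotents fun e he => ?_
  have he' : ∀ x, e (e x) = e x := LinearMap.congr_fun he
  obtain ⟨f, hf⟩ := hL (e ∘ₗ Submodule.mkQ _)
  have hex : ∀ x : M, ∃ m : M, Submodule.Quotient.mk m = e (Submodule.Quotient.mk x) ∧
      f x - m ∈ maximalIdeal R • (⊤ : Submodule R M) := fun x => by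
    obtain ⟨m, hm⟩ := Submodule.Quotient.mk_surjective _ (e (Submodule.Quotient.mk x))
    exact ⟨m, hm, hf x m hm⟩
  obtain ⟨ε, hε, hεf⟩ := exists_idempotent_of_isAdicComplete (maximalIdeal R) f (fun x => by
    obtain ⟨m, hm, hfm⟩ := hex x
    have h1 := hf m m (by
      change _ = e (Submodule.Quotient.mk m)
      rw [hm, he'])
    have h2 := sub_mem (add_mem (mem_smul_top_apply f hfm) h1) hfm
    convert h2 using 1
    rw [map_sub]
    abel)
  rcases hM.eq_zero_or_eq_id hε with rfl | rfl
  · left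
    refine eq_zero_of_idempotent_of_mem he fun x => ?_
    obtain ⟨x, rfl⟩ := Submodule.Quotient.mk_surjective _ x
    obtain ⟨m, hm, hfm⟩ := hex x
    rw [← hm, mk_mem_smul_top_iff hJ]
    have := neg_mem (add_mem (hεf x) hfm)
    simpa using this
  · right
    rw [eq_comm, ← sub_eq_zero]
    refine eq_zero_of_idempotent_of_mem ?_ fun x => ?_
    · ext x
      simp [he']
    · obtain ⟨x, rfl⟩ := Submodule.Quotient.mk_surjective _ x
      obtain ⟨m, hm, hfm⟩ := hex x
      rw [LinearMap.sub_apply, LinearMap.id_apply, ← hm, ← Submodule.Quotient.mk_sub,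
        mk_mem_smul_top_iff hJ]
      have := add_mem (hεf x) hfm
      simpa using this

lemma exists_bijective_comp_of_redMap_comp_eq_id [Module.Finite R X] {h : M →ₗ[R] X}
    {s : Red R J X →ₗ[R] Red R J M} (hs : redMap J h ∘ₗ s = LinearMap.id)
    (hL : LiftsModulo R J X M (maximalIdeal R)) :
    ∃ t : X →ₗ[R] M, (∀ x, h (t x) - x ∈ maximalIdeal R • (⊤ : Submodule R X)) ∧
      Function.Bijective (h ∘ₗ t) := by
  obtain ⟨t, ht⟩ := hL (s ∘ₗ Submodule.mkQ _)
  have key : ∀ x, h (t x) - x ∈ maximalIdeal R • (⊤ : Submodule R X) := fun x => by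
    obtain ⟨m, hm⟩ := Submodule.Quotient.mk_surjective _ (s (Submodule.Quotient.mk x))
    have h1 := mem_smul_top_apply h (ht x m hm)
    have h2 : (Submodule.Quotient.mk (h m) : Red R J X) = Submodule.Quotient.mk x := by
      rw [← redMap_mk, hm]
      exact LinearMap.congr_fun hs _
    rw [Submodule.Quotient.eq] at h2
    have h3 := add_mem h1 (Submodule.smul_mono_left hJ h2)
    rwa [map_sub, sub_add_sub_cancel] at h3
  exact ⟨t, key, bijective_of_sub_mem key⟩

lemma nonempty_linearEquiv_of_redMap_comp_eq_id [Module.Finite R X] [Nontrivial X]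
    (hM : IsIndecomposable R M) {h : M →ₗ[R] X}
    {s : Red R J X →ₗ[R] Red R J M} (hs : redMap J h ∘ₗ s = LinearMap.id)
    (hL : LiftsModulo R J X M (maximalIdeal R)) : Nonempty (M ≃ₗ[R] X) := by
  obtain ⟨t, -, hb⟩ := exists_bijective_comp_of_redMap_comp_eq_id hJ hs hL
  let e := LinearEquiv.ofBijective _ hb
  have he : (e.symm.toLinearMap ∘ₗ h) ∘ₗ t = LinearMap.id := by
    ext x
    exact e.symm_apply_apply x
  exact ⟨(LinearEquiv.ofBijective t (hM.bijective_of_leftInverse he)).symm⟩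

end Reduction

section FiniteLength

variable {R : Type u} [CommRing R] [IsNoetherianRing R] [IsLocalRing R] {ys : List R} {a : ℕ}

lemma Setup.length_quotient_ne_top (S : Setup R ys a) :
    Module.length R (R ⧸ Ideal.ofList ys) ≠ ⊤ := by
  have hreg : RingTheory.Sequence.IsRegular R ys :=
    .of_isWeaklyRegular_of_mem_maximalIdeal _ S.mem S.reg
  have hd := ringKrullDim_add_length_eq_ringKrullDim_of_isRegular ys hreg
  have h0 : Ring.KrullDimLE 0 (R ⧸ Ideal.ofList ys) := by
    rw [Ring.krullDimLE_iff]
    rw [← S.len] at hd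
    generalize ringKrullDim (R ⧸ Ideal.ofList ys) = d at hd
    induction d with
    | bot => simp
    | coe d =>
      have : d + (ys.length : ℕ∞) = 0 + ys.length := by
        rw [zero_add]
        exact_mod_cast hd
      rw [ENat.add_left_injective_of_ne_top (ENat.natCast_ne_top _) this]
      simp
  have : IsArtinianRing (R ⧸ Ideal.ofList ys) :=
    isArtinianRing_iff_isNoetherianRing_krullDimLE_zero.2 ⟨inferInstance, h0⟩
  have : IsArtinian R (R ⧸ Ideal.ofList ys) :=
    isArtinian_of_surjective_algebraMap (R := R ⧸ Ideal.ofList ys) Ideal.Quotient.mk_surjective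
  exact Module.length_ne_top

end FiniteLength

section Cogenerator

variable {R : Type u} [CommRing R] (J : Ideal R)

/-- `N` is a finite module annihilated by `J`. -/
def FinKilled (N : Type u) [AddCommGroup N] [Module R N] : Prop :=
  Module.Finite R N ∧ ∀ r ∈ J, ∀ x : N, r • x = 0

variable {J} {M N W : Type u} [AddCommGroup M] [Module R M] [AddCommGroup N] [Module R N]
  [AddCommGroup W] [Module R W]

lemma finKilled_red [Module.Finite R M] : FinKilled J (Red R J M) :=
  ⟨inferInstance, fun _ hr x => smul_red_eq_zero J hr x⟩

lemma FinKilled.pi (hM : FinKilled J M) (n : ℕ) : FinKilled J (Fin n → M) := by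
  have := hM.1
  exact ⟨inferInstance, fun r hr x => funext fun i => hM.2 r hr (x i)⟩

lemma FinKilled.prod (hM : FinKilled J M) (hN : FinKilled J N) : FinKilled J (M × N) := by
  have := hM.1
  have := hN.1
  exact ⟨inferInstance, fun r hr x => Prod.ext (hM.2 r hr x.1) (hN.2 r hr x.2)⟩

lemma FinKilled.submodule [IsNoetherianRing R] (hM : FinKilled J M) (T : Submodule R M) :
    FinKilled J T := by
  have := hM.1
  exact ⟨inferInstance, fun r hr x => Subtype.ext (hM.2 r hr x)⟩

lemma FinKilled.quotient (hM : FinKilled J M) (T : Submodule R M) : FinKilled J (M ⧸ T) := by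
  have := hM.1
  refine ⟨inferInstance, fun r hr x => ?_⟩
  obtain ⟨x, rfl⟩ := Submodule.Quotient.mk_surjective _ x
  rw [← Submodule.Quotient.mk_smul, hM.2 r hr, Submodule.Quotient.mk_zero]

lemma FinKilled.isArtinian [IsNoetherianRing R] (hM : FinKilled J M)
    (hJ : Module.length R (R ⧸ J) ≠ ⊤) : IsArtinian R M := by
  have := hM.1
  obtain ⟨n, p, hp⟩ := Module.Finite.exists_fin' R M
  have h1 := length_quotient_smul_top_le J le_rfl hp
  have h2 : J • (⊤ : Submodule R M) = ⊥ := by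
    rw [eq_bot_iff, Submodule.smul_le]
    intro r hr x _
    exact hM.2 r hr x
  rw [(Submodule.quotEquivOfEqBot _ h2).length_eq] at h1
  have h3 : Module.length R M ≠ ⊤ :=
    ne_top_of_le_ne_top (WithTop.mul_ne_top (ENat.natCast_ne_top n) hJ) h1
  exact (isFiniteLength_iff_isNoetherian_isArtinian.1 (Module.length_ne_top_iff.1 h3)).2

variable [IsLocalRing R]

variable (J) in
/-- `N` is a finite module annihilated by `J` and `s` generates its simple essential socle. -/
structure HasSocle (N : Type u) [AddCommGroup N] [Module R N] (s : N) : Prop where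
  fin : FinKilled J N
  ne_zero : s ≠ 0
  smul_eq_zero : ∀ r ∈ maximalIdeal R, r • s = 0
  exists_smul : ∀ z : N, z ≠ 0 → ∃ a : R, a • z = s

lemma length_span_singleton_le {s : N} (h : ∀ r ∈ maximalIdeal R, r • s = 0) :
    Module.length R (Submodule.span R {s}) ≤ 1 := by
  have hs : IsSimpleModule R (R ⧸ maximalIdeal R) :=
    isSimpleModule_iff_quot_maximal.2 ⟨_, inferInstance, ⟨LinearEquiv.refl _ _⟩⟩
  rw [← Module.length_eq_one R (R ⧸ maximalIdeal R)]
  let p : R →ₗ[R] Submodule.span R {s} :=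
    LinearMap.toSpanSingleton R _ ⟨s, Submodule.mem_span_singleton_self s⟩
  refine Module.length_le_of_surjective ((maximalIdeal R).liftQ p fun r hr => ?_) ?_
  · exact Subtype.ext (h r hr)
  · rintro ⟨x, hx⟩
    obtain ⟨r, rfl⟩ := Submodule.mem_span_singleton.1 hx
    exact ⟨Submodule.Quotient.mk r, rfl⟩

omit [IsLocalRing R] in
lemma length_quotient_sup_span_add_one_le {I : Ideal R} {a : R} (ha : a ∉ I) :
    Module.length R (R ⧸ (I ⊔ Ideal.span {a})) + 1 ≤ Module.length R (R ⧸ I) := by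
  let f : (R ⧸ I) →ₗ[R] (R ⧸ (I ⊔ Ideal.span {a})) :=
    Submodule.mapQ I (I ⊔ Ideal.span {a}) LinearMap.id le_sup_left
  have hf : Function.Surjective f := fun x => by
    obtain ⟨x, rfl⟩ := Submodule.Quotient.mk_surjective _ x
    exact ⟨Submodule.Quotient.mk x, rfl⟩
  rw [Module.length_eq_add_of_exact (LinearMap.ker f).subtype f
    (LinearMap.ker f).injective_subtype hf (LinearMap.exact_subtype_ker_map f), add_comm]
  gcongr
  refine Order.one_le_iff_ne_zero.2 fun h0 => ha ?_
  rw [Module.length_eq_zero_iff] at h0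
  have hk : (Submodule.Quotient.mk a : R ⧸ I) ∈ LinearMap.ker f := by
    change (Submodule.Quotient.mk a : R ⧸ (I ⊔ Ideal.span {a})) = 0
    rw [Submodule.Quotient.mk_eq_zero]
    exact Submodule.mem_sup_right (Ideal.mem_span_singleton_self a)
  have := congrArg Subtype.val (Subsingleton.elim (⟨_, hk⟩ : LinearMap.ker f) 0)
  exact (Submodule.Quotient.mk_eq_zero I).1 this

variable [IsNoetherianRing R]

lemma HasSocle.length_le {n : ℕ} (hn : maximalIdeal R ^ n ≤ J) {s : N} (hN : HasSocle J N s) :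
    Module.length R N ≤ Module.length R (R ⧸ J) := by
  have main : ∀ I : Ideal R, maximalIdeal R ^ n ≤ I → ∀ T : Submodule R N,
      (∀ z ∈ T, ∀ r ∈ I, r • z = 0) → Module.length R T ≤ Module.length R (R ⧸ I) := by
    intro I
    induction I using WellFoundedGT.induction with
    | ind I ih =>
    intro hI T hT
    by_cases htop : I = ⊤
    · have : Subsingleton T := ⟨fun x y => by
        have h0 : ∀ z : T, z = 0 := fun z => Subtype.ext (by
          have := hT z z.2 1 (htop ▸ Submodule.mem_top)
          rwa [one_smul] at this)
        rw [h0 x, h0 y]⟩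
      rw [Module.length_eq_zero_iff.2 this]
      exact zero_le
    · obtain ⟨a, haI, ha⟩ : ∃ a ∉ I, ∀ r ∈ maximalIdeal R, r * a ∈ I := by
        classical
        have hex : ∃ k, maximalIdeal R ^ k ≤ I := ⟨n, hI⟩
        have h1 := Nat.find_spec hex
        have h0 : Nat.find hex ≠ 0 := fun h0 => by
          rw [h0, pow_zero, Ideal.one_eq_top, top_le_iff] at h1
          exact htop h1
        obtain ⟨k, hk⟩ := Nat.exists_eq_succ_of_ne_zero h0
        have h2 : ¬ maximalIdeal R ^ k ≤ I := Nat.find_min hex (by omega)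
        obtain ⟨a, ha, haI⟩ := SetLike.not_le_iff_exists.1 h2
        refine ⟨a, haI, fun r hr => h1 ?_⟩
        rw [hk, pow_succ']
        exact Ideal.mul_mem_mul hr ha
      let f : T →ₗ[R] Submodule.span R {s} :=
        LinearMap.codRestrict _ (LinearMap.lsmul R N a ∘ₗ T.subtype) fun z => by
          by_cases hz : a • (z : N) = 0
          · simp [hz]
          · obtain ⟨b, hb⟩ := hN.exists_smul _ hz
            have hbu : IsUnit b := by
              by_contra hbu
              apply hN.ne_zero
              rw [← hb, smul_smul]
              exact hT z z.2 _ (ha b ((mem_maximalIdeal b).2 hbu))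
            obtain ⟨u, rfl⟩ := hbu
            refine Submodule.mem_span_singleton.2 ⟨(↑u⁻¹ : R), ?_⟩
            rw [← hb, smul_smul, Units.inv_mul, one_smul]
            rfl
      have hker : Module.length R (LinearMap.ker f) ≤ Module.length R (R ⧸ (I ⊔ Ideal.span {a})) := by
        rw [(Submodule.equivSubtypeMap T (LinearMap.ker f)).length_eq]
        refine ih _ ?_ (hI.trans le_sup_left) _ ?_
        · exact lt_of_le_of_ne le_sup_left fun h =>
            haI (h ▸ Submodule.mem_sup_right (Ideal.mem_span_singleton_self a))
        · rintro _ ⟨z, hz, rfl⟩ r hr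
          obtain ⟨i, hi, y, hy, rfl⟩ := Submodule.mem_sup.1 hr
          obtain ⟨c, rfl⟩ := Ideal.mem_span_singleton'.1 hy
          have h1 : a • (z : N) = 0 := congrArg Subtype.val hz
          have h2 := hT z z.2 i hi
          rw [add_smul, mul_smul]
          change i • (z : N) + c • a • (z : N) = 0
          rw [h1, h2, smul_zero, zero_add]
      have hrange : Module.length R (LinearMap.range f) ≤ 1 :=
        (Module.length_le_of_injective (LinearMap.range f).subtype
          (LinearMap.range f).injective_subtype).trans (length_span_singleton_le hN.smul_eq_zero)
      rw [Module.length_eq_add_of_exact (LinearMap.ker f).subtype f.rangeRestrict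
        (LinearMap.ker f).injective_subtype f.surjective_rangeRestrict
        (by rw [← LinearMap.ker_rangeRestrict]; exact LinearMap.exact_subtype_ker_map _)]
      exact (add_le_add hker hrange).trans (length_quotient_sup_span_add_one_le haI)
  rw [← Module.length_top]
  exact main J hn ⊤ fun z _ r hr => hN.fin.2 r hr z

/-- The module `E` is relatively injective and contains the residue field. -/
lemma exists_injective_cogenerator (hJ : J ≤ maximalIdeal R) {n : ℕ} (hn : maximalIdeal R ^ n ≤ J)
    (hl : Module.length R (R ⧸ J) ≠ ⊤) :
    ∃ (E : Type u) (_ : AddCommGroup E) (_ : Module R E), FinKilled J E ∧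
      (∀ (A W : Type u) [AddCommGroup A] [Module R A] [AddCommGroup W] [Module R W]
        (P : A →ₗ[R] W) (φ : A →ₗ[R] E), FinKilled J W → LinearMap.ker P ≤ LinearMap.ker φ →
          ∃ Φ : W →ₗ[R] E, Φ ∘ₗ P = φ) ∧
      (∀ (Q : Type u) [AddCommGroup Q] [Module R Q], Module.Finite R Q → Nontrivial Q →
        ∃ ξ : Q →ₗ[R] E, ξ ≠ 0) := by
  obtain ⟨ℓ, hℓ⟩ := ENat.ne_top_iff_exists.1 hl
  let T : Set ℕ := {k | ∃ (N : Type u) (_ : AddCommGroup N) (_ : Module R N) (s : N),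
    HasSocle J N s ∧ Module.length R N = k}
  have hTb : BddAbove T := by
    refine ⟨ℓ, ?_⟩
    rintro k ⟨N, _, _, s, hN, hk⟩
    have := hN.length_le hn
    rw [hk, ← hℓ] at this
    exact_mod_cast this
  have hmemT : ∀ (N : Type u) [AddCommGroup N] [Module R N] (s : N), HasSocle J N s →
      ∃ k ∈ T, Module.length R N = k := by
    intro N _ _ s hN
    have h1 : Module.length R N ≠ ⊤ := ne_top_of_le_ne_top hl (hN.length_le hn)
    obtain ⟨k, hk⟩ := ENat.ne_top_iff_exists.1 h1
    exact ⟨k, ⟨N, _, _, s, hN, hk.symm⟩, hk.symm⟩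
  have hTn : T.Nonempty := by
    obtain ⟨k, hk, -⟩ := hmemT (R ⧸ maximalIdeal R) (Submodule.Quotient.mk 1)
      { fin := ⟨inferInstance, fun r hr x => by
          obtain ⟨x, rfl⟩ := Submodule.Quotient.mk_surjective _ x
          rw [← Submodule.Quotient.mk_smul, Submodule.Quotient.mk_eq_zero]
          exact Ideal.mul_mem_right _ _ (hJ hr)⟩
        ne_zero := by
          rw [Ne, Submodule.Quotient.mk_eq_zero]
          exact (Ideal.ne_top_iff_one _).1 (Ideal.IsPrime.ne_top inferInstance)
        smul_eq_zero := fun r hr => by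
          rw [← Submodule.Quotient.mk_smul, Submodule.Quotient.mk_eq_zero]
          exact Ideal.mul_mem_right _ _ hr
        exists_smul := fun z hz => by
          obtain ⟨z, rfl⟩ := Submodule.Quotient.mk_surjective _ z
          rw [Ne, Submodule.Quotient.mk_eq_zero, notMem_maximalIdeal] at hz
          obtain ⟨u, rfl⟩ := hz
          exact ⟨(↑u⁻¹ : R), by rw [← Submodule.Quotient.mk_smul, smul_eq_mul, Units.inv_mul]⟩ }
    exact ⟨k, hk⟩
  obtain ⟨E, _, _, s, hE, hk⟩ := Nat.sSup_mem hTn hTb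
  have hEA := hE.fin.isArtinian hl
  have hEf := hE.fin.1
  have hmax : ∀ (N : Type u) [AddCommGroup N] [Module R N] (t : N), HasSocle J N t →
      Module.length R N ≤ Module.length R E := by
    intro N _ _ t hN
    obtain ⟨k, hk', hN'⟩ := hmemT N t hN
    rw [hN', hk]
    exact_mod_cast le_csSup hTb hk'
  refine ⟨E, _, _, hE.fin, ?_, ?_⟩
  · intro A W _ _ _ _ P φ hW hPφ
    have := hW.1
    have hWE := hW.prod hE.fin
    have hnoeth : IsNoetherian R (W × E) := have := hWE.1; inferInstance
    obtain ⟨C, ⟨hKC, hsC⟩, hCmax⟩ := set_has_maximal_iff_noetherian.2 hnoeth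
      {C | LinearMap.range (P.prod (-φ)) ≤ C ∧ ((0 : W), s) ∉ C} ⟨_, le_rfl, by
        rintro ⟨a, ha⟩
        have h1 : P a = 0 := congrArg Prod.fst ha
        have h2 : -φ a = s := congrArg Prod.snd ha
        have h3 : φ a = 0 := hPφ h1
        exact hE.ne_zero (by rw [← h2, h3, neg_zero])⟩
    let i : E →ₗ[R] (W × E) ⧸ C := C.mkQ ∘ₗ LinearMap.inr R W E
    have hi : Function.Injective i := by
      rw [injective_iff_map_eq_zero]
      intro z hz
      by_contra hz0
      obtain ⟨a, rfl⟩ := hE.exists_smul z hz0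
      have h1 : ((0 : W), z) ∈ C := (Submodule.Quotient.mk_eq_zero C).1 hz
      have h2 := C.smul_mem a h1
      rw [Prod.smul_mk, smul_zero] at h2
      exact hsC h2
    have hQ : HasSocle J ((W × E) ⧸ C) (i s) :=
      { fin := hWE.quotient C
        ne_zero := fun h => hsC ((Submodule.Quotient.mk_eq_zero C).1 h)
        smul_eq_zero := fun r hr => by
          rw [← map_smul, hE.smul_eq_zero r hr, map_zero]
        exists_smul := fun z hz => by
          obtain ⟨w, rfl⟩ := Submodule.Quotient.mk_surjective _ z
          rw [Ne, Submodule.Quotient.mk_eq_zero] at hz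
          have h1 := hCmax (C ⊔ Submodule.span R {w})
          have h2 : C < C ⊔ Submodule.span R {w} := lt_of_le_of_ne le_sup_left fun h =>
            hz (h ▸ Submodule.mem_sup_right (Submodule.mem_span_singleton_self w))
          have h3 : ((0 : W), s) ∈ C ⊔ Submodule.span R {w} := by
            by_contra h3
            exact h1 ⟨hKC.trans le_sup_left, h3⟩ h2
          obtain ⟨c, hc, y, hy, hcy⟩ := Submodule.mem_sup.1 h3
          obtain ⟨a, rfl⟩ := Submodule.mem_span_singleton.1 hy
          refine ⟨a, ?_⟩
          change _ = Submodule.Quotient.mk ((0 : W), s)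
          rw [← hcy, Submodule.Quotient.mk_add, (Submodule.Quotient.mk_eq_zero C).2 hc, zero_add,
            Submodule.Quotient.mk_smul] }
    have hQA := hQ.fin.isArtinian hl
    have hsurj : Function.Surjective i := by
      rw [← LinearMap.range_eq_top]
      by_contra hne
      have h1 := Submodule.length_lt hne
      rw [← (LinearEquiv.ofInjective i hi).length_eq] at h1
      exact absurd (hmax _ _ hQ) (not_le.2 h1)
    let e := LinearEquiv.ofBijective i ⟨hi, hsurj⟩
    refine ⟨e.symm.toLinearMap ∘ₗ C.mkQ ∘ₗ LinearMap.inl R W E, ?_⟩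
    ext a
    change e.symm (Submodule.Quotient.mk (P a, 0)) = φ a
    rw [LinearEquiv.symm_apply_eq]
    change _ = Submodule.Quotient.mk (0, φ a)
    rw [Submodule.Quotient.eq]
    have : (P a, (0 : E)) - (0, φ a) = (P.prod (-φ)) a := by
      ext <;> simp
    rw [this]
    exact hKC ⟨a, rfl⟩
  · intro Q _ _ _ _
    obtain ⟨C, hC⟩ := IsCoatomic.exists_coatom (Submodule R Q)
    obtain ⟨I, hI, ⟨e⟩⟩ := isSimpleModule_iff_quot_maximal.1 (isSimpleModule_iff_isCoatom.2 hC)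
    rw [eq_maximalIdeal hI] at e
    let κ : (R ⧸ maximalIdeal R) →ₗ[R] E :=
      (maximalIdeal R).liftQ (LinearMap.toSpanSingleton R E s) fun r hr => hE.smul_eq_zero r hr
    refine ⟨κ ∘ₗ e.toLinearMap ∘ₗ C.mkQ, fun h => hE.ne_zero ?_⟩
    obtain ⟨q, hq⟩ := C.mkQ_surjective (e.symm (Submodule.Quotient.mk 1))
    have := LinearMap.congr_fun h q
    simp only [LinearMap.comp_apply, hq, LinearEquiv.coe_coe, LinearEquiv.apply_symm_apply] at this
    have h1 : κ (Submodule.Quotient.mk 1) = 0 := this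
    change LinearMap.toSpanSingleton R E s 1 = 0 at h1
    rwa [LinearMap.toSpanSingleton_apply, one_smul] at h1

end Cogenerator

section AlmostSplit

variable {R : Type u} [CommRing R] {X : Type u} [AddCommGroup X] [Module R X]

/-- Fitting's lemma for an indecomposable module. -/
lemma IsIndecomposable.bijective_or_isNilpotent [IsNoetherian R X] [IsArtinian R X]
    (hX : IsIndecomposable R X) (f : Module.End R X) :
    Function.Bijective f ∨ IsNilpotent f := by
  obtain ⟨n, hn, h1⟩ := ((LinearMap.eventually_isCompl_ker_pow_range_pow f).and
    (Filter.eventually_ge_atTop 1)).exists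
  rcases hX.2 _ _ hn with h | h
  · left
    refine IsArtinian.bijective_of_injective_endomorphism f ?_
    rw [LinearMap.ker_eq_bot] at h
    obtain ⟨m, rfl⟩ := Nat.exists_eq_add_of_le' h1
    rw [pow_succ] at h
    exact Function.Injective.of_comp (f := ⇑(f ^ m)) h
  · right
    exact ⟨n, LinearMap.range_eq_bot.1 h⟩

lemma IsIndecomposable.bijective_of_add [IsNoetherian R X] [IsArtinian R X]
    (hX : IsIndecomposable R X) {f g : Module.End R X} (h : Function.Bijective (f + g)) :
    Function.Bijective f ∨ Function.Bijective g := by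
  obtain ⟨u, hu⟩ := (Module.End.isUnit_iff _).2 h
  rcases hX.bijective_or_isNilpotent (↑u⁻¹ * f) with h1 | h1
  · left
    rw [← Module.End.isUnit_iff] at h1 ⊢
    exact (Units.isUnit_units_mul u⁻¹ f).1 h1
  · right
    have h2 : 1 - ↑u⁻¹ * f = ↑u⁻¹ * g := by
      rw [sub_eq_iff_eq_add', ← mul_add, ← hu, Units.inv_mul]
    have h3 := h1.isUnit_one_sub
    rw [h2] at h3
    rw [← Module.End.isUnit_iff]
    exact (Units.isUnit_units_mul u⁻¹ g).1 h3

/-- The nonbijective endomorphisms of an indecomposable module of finite length. -/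
def radicalEnd [IsNoetherian R X] [IsArtinian R X] (hX : IsIndecomposable R X) :
    Submodule R (X →ₗ[R] X) where
  carrier := {f | ¬ Function.Bijective f}
  zero_mem' := fun h => by
    have := hX.1
    obtain ⟨x, hx⟩ := exists_ne (0 : X)
    exact hx (h.1 rfl)
  add_mem' := fun {f g} hf hg h => (hX.bijective_of_add (f := f) (g := g) h).elim hf hg
  smul_mem' := fun r f hf h => hf ⟨fun x y hxy => h.1 (by simp [hxy]), fun y => by
    obtain ⟨x, rfl⟩ := h.2 y
    exact ⟨r • x, by simp⟩⟩

/-- Over an Artinian quotient of a local ring, there is a right almost split map onto any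
indecomposable finite module. -/
theorem exists_right_almost_split [IsLocalRing R] [IsNoetherianRing R] {J : Ideal R}
    (hJ : J ≤ maximalIdeal R) {n : ℕ} (hn : maximalIdeal R ^ n ≤ J)
    (hl : Module.length R (R ⧸ J) ≠ ⊤) (hXJ : FinKilled J X) (hX : IsIndecomposable R X) :
    ∃ (B : Type u) (_ : AddCommGroup B) (_ : Module R B), FinKilled J B ∧ ∃ β : B →ₗ[R] X,
      (¬ ∃ s : X →ₗ[R] B, β ∘ₗ s = LinearMap.id) ∧
      ∀ (M : Type u) (_ : AddCommGroup M) (_ : Module R M), FinKilled J M →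
        ∀ h : M →ₗ[R] X, (¬ ∃ s : X →ₗ[R] M, h ∘ₗ s = LinearMap.id) →
          ∃ g : M →ₗ[R] B, β ∘ₗ g = h := by
  have := hXJ.1
  have := hXJ.isArtinian hl
  obtain ⟨E, _, _, hE, hinj, hcog⟩ := exists_injective_cogenerator hJ hn hl
  obtain ⟨n, e, he⟩ := Module.Finite.exists_fin' R X
  obtain ⟨m, ρ, hρ⟩ := Submodule.fg_iff_exists_fin_generating_family.1
    (IsNoetherian.noetherian (LinearMap.ker e))
  have hρe (j : Fin m) : e (ρ j) = 0 := by
    have : ρ j ∈ LinearMap.ker e := hρ ▸ Submodule.subset_span ⟨j, rfl⟩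
    exact this
  let x (i : Fin n) : X := e (Pi.single i 1)
  have hex (c : Fin n → R) : e c = ∑ i, c i • x i := by
    conv_lhs => rw [← Finset.univ_sum_single c]
    rw [map_sum]
    refine Finset.sum_congr rfl fun i _ => ?_
    rw [← map_smul, ← Pi.single_smul, smul_eq_mul, mul_one]
  let Ev : (X →ₗ[R] X) →ₗ[R] (Fin n → X) := LinearMap.pi fun i => LinearMap.applyₗ (x i)
  have hEv : LinearMap.ker Ev = ⊥ := by
    rw [LinearMap.ker_eq_bot']
    intro f hf
    ext y
    obtain ⟨c, rfl⟩ := he y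
    rw [hex, map_sum, LinearMap.zero_apply]
    refine Finset.sum_eq_zero fun i _ => ?_
    rw [map_smul]
    have : f (x i) = 0 := congrFun hf i
    rw [this, smul_zero]
  have hfin : Module.Finite R (X →ₗ[R] X) :=
    Module.Finite.of_injective Ev (LinearMap.ker_eq_bot.1 hEv)
  have hnt : Nontrivial ((X →ₗ[R] X) ⧸ radicalEnd hX) := by
    rw [Submodule.Quotient.nontrivial_iff]
    intro h
    have : LinearMap.id ∈ radicalEnd hX := h ▸ Submodule.mem_top
    exact this Function.bijective_id
  obtain ⟨ξ', hξ'⟩ := hcog _ inferInstance hnt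
  let ξ₀ := ξ' ∘ₗ (radicalEnd hX).mkQ
  have hξ₀ (f : X →ₗ[R] X) (hf : ¬ Function.Bijective f) : ξ₀ f = 0 := by
    have : (radicalEnd hX).mkQ f = 0 := (Submodule.Quotient.mk_eq_zero _).2 hf
    change ξ' ((radicalEnd hX).mkQ f) = 0
    rw [this, map_zero]
  obtain ⟨ξ, hξ⟩ := hinj _ _ Ev ξ₀ (hXJ.pi n) (hEv ▸ bot_le)
  have hξEv (f : X →ₗ[R] X) : ξ (fun i => f (x i)) = ξ₀ f := LinearMap.congr_fun hξ f
  have hξs (w : Fin n → X) : ξ w = ∑ i, ξ (Pi.single i (w i)) := by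
    conv_lhs => rw [← Finset.univ_sum_single w]
    rw [map_sum]
  let δ : X × (Fin m → E) →ₗ[R] (Fin n → E) := LinearMap.pi fun i =>
    (ξ ∘ₗ LinearMap.single R (fun _ => X) i) ∘ₗ LinearMap.fst R _ _ -
      (∑ j, ρ j i • LinearMap.proj j) ∘ₗ LinearMap.snd R _ _
  have hδ (b : X × (Fin m → E)) : b ∈ LinearMap.ker δ ↔
      ∀ i, ξ (Pi.single i b.1) = ∑ j, ρ j i • b.2 j := by
    rw [LinearMap.mem_ker, funext_iff]
    refine forall_congr' fun i => ?_
    simp [δ, sub_eq_zero]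
  refine ⟨LinearMap.ker δ, inferInstance, inferInstance,
    (hXJ.prod (hE.pi m)).submodule _, LinearMap.fst R _ _ ∘ₗ (LinearMap.ker δ).subtype, ?_, ?_⟩
  · rintro ⟨s, hs⟩
    refine hξ' ?_
    suffices h : ξ₀ = 0 by
      ext f
      exact LinearMap.congr_fun h f
    ext f
    rw [← hξEv, hξs, LinearMap.zero_apply]
    have h1 (y : X) : (s y : X × (Fin m → E)).1 = y := LinearMap.congr_fun hs y
    have h2 (i : Fin n) : ξ (Pi.single i (f (x i))) =
        ∑ j, ρ j i • (s (f (x i)) : X × (Fin m → E)).2 j := by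
      rw [← (hδ _).1 (s (f (x i))).2 i, h1]
    simp only [h2]
    rw [Finset.sum_comm]
    refine Finset.sum_eq_zero fun j _ => ?_
    have h3 : f (e (ρ j)) = 0 := by rw [hρe, map_zero]
    rw [hex, map_sum] at h3
    have h4 : ((s (∑ i, f (ρ j i • x i)) : LinearMap.ker δ) : X × (Fin m → E)).2 j = 0 := by
      rw [h3, map_zero]
      rfl
    rw [← h4, map_sum]
    simp [Prod.snd_sum]
  · intro M _ _ hM h hh
    let P : (Fin n → M) →ₗ[R] (Fin m → M) := LinearMap.pi fun j => ∑ i, ρ j i • LinearMap.proj i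
    have hP (u : Fin n → M) (j : Fin m) : P u j = ∑ i, ρ j i • u i := by
      simp [P]
    obtain ⟨Φ, hΦ⟩ := hinj _ _ P (ξ ∘ₗ h.compLeft (Fin n)) (hM.pi m) (by
      intro u hu
      let τ : (Fin n → R) →ₗ[R] M := ∑ i, (LinearMap.proj i).smulRight (u i)
      have hτ (c : Fin n → R) : τ c = ∑ i, c i • u i := by simp [τ]
      have hker : LinearMap.ker e ≤ LinearMap.ker τ := by
        rw [← hρ, Submodule.span_le]
        rintro _ ⟨j, rfl⟩
        change τ (ρ j) = 0
        rw [hτ, ← hP]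
        exact congrFun hu j
      let t : X →ₗ[R] M := (LinearMap.ker e).liftQ τ hker ∘ₗ
        (LinearMap.quotKerEquivOfSurjective e he).symm.toLinearMap
      have ht (c : Fin n → R) : t (e c) = τ c := by
        have : (LinearMap.quotKerEquivOfSurjective e he).symm (e c) =
            Submodule.Quotient.mk c := by
          rw [LinearEquiv.symm_apply_eq]
          rfl
        change (LinearMap.ker e).liftQ τ hker
          ((LinearMap.quotKerEquivOfSurjective e he).symm (e c)) = _
        rw [this]
        rfl
      have htx (i : Fin n) : t (x i) = u i := by
        rw [ht, hτ, Finset.sum_eq_single i]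
        · simp
        · intro j _ hj
          simp [hj]
        · simp
      have h0 := hξ₀ (h ∘ₗ t) fun hbij => hh
        ⟨t ∘ₗ (LinearEquiv.ofBijective _ hbij).symm.toLinearMap, by
          ext y
          exact (LinearEquiv.ofBijective _ hbij).apply_symm_apply y⟩
      rw [← hξEv] at h0
      change ξ (fun i => h (u i)) = 0
      rw [← h0]
      congr 1
      ext i
      rw [LinearMap.comp_apply, htx])
    have hΦP (u : Fin n → M) : Φ (P u) = ξ (fun i => h (u i)) := LinearMap.congr_fun hΦ u
    let g : M →ₗ[R] X × (Fin m → E) :=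
      h.prod (LinearMap.pi fun j => Φ ∘ₗ LinearMap.single R (fun _ => M) j)
    refine ⟨g.codRestrict (LinearMap.ker δ) fun z => (hδ _).2 fun i => ?_, ?_⟩
    · change ξ (Pi.single i (h z)) = ∑ j, ρ j i • Φ (Pi.single j z)
      have h1 : (Pi.single i (h z) : Fin n → X) = fun k => h ((Pi.single i z : Fin n → M) k) := by
        ext k
        by_cases hk : k = i
        · subst hk; simp
        · simp [hk]
      rw [h1, ← hΦP, ← Finset.univ_sum_single (P (Pi.single i z)), map_sum]
      refine Finset.sum_congr rfl fun j _ => ?_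
      rw [← map_smul, ← Pi.single_smul, hP, Finset.sum_eq_single i]
      · simp
      · intro k _ hk
        simp [hk]
      · simp
    · ext z
      rfl

end AlmostSplit

section HaradaSai

variable (R : Type u) [CommRing R] (c : ℕ)

/-- `A` is indecomposable of length at most `c`. -/
def ShortIndecomposable (A : Type u) [AddCommGroup A] [Module R A] : Prop :=
  IsIndecomposable R A ∧ Module.length R A ≤ c

/-- `h` is a composite of `n` nonbijective maps between indecomposable modules of length at most
`c`, followed by an arbitrary map. -/
def IsNonisoComp : ∀ (_ : ℕ) {A B : Type u} [AddCommGroup A] [Module R A] [AddCommGroup B]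
    [Module R B] (_ : A →ₗ[R] B), Prop
  | 0, A, B, _, _, _, _, _ => ShortIndecomposable R c A ∧ ShortIndecomposable R c B
  | n + 1, A, B, _, _, _, _, h => ShortIndecomposable R c A ∧
      ∃ (C : Type u) (_ : AddCommGroup C) (_ : Module R C) (f : A →ₗ[R] C) (g : C →ₗ[R] B),
        ¬ Function.Bijective f ∧ IsNonisoComp n g ∧ h = g ∘ₗ f

variable {R c} {A B : Type u} [AddCommGroup A] [Module R A] [AddCommGroup B] [Module R B]

lemma IsNonisoComp.source {n : ℕ} {h : A →ₗ[R] B} (hh : IsNonisoComp R c n h) :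
    ShortIndecomposable R c A := by
  cases n <;> exact hh.1

lemma IsNonisoComp.exists_comp {p q : ℕ} : ∀ {A : Type u} [AddCommGroup A] [Module R A]
    {h : A →ₗ[R] B}, IsNonisoComp R c (p + q) h →
    ∃ (C : Type u) (_ : AddCommGroup C) (_ : Module R C) (f : A →ₗ[R] C) (g : C →ₗ[R] B),
      IsNonisoComp R c p f ∧ IsNonisoComp R c q g ∧ h = g ∘ₗ f := by
  induction p with
  | zero =>
    intro A _ _ h hh
    rw [zero_add] at hh
    exact ⟨A, _, _, LinearMap.id, h, ⟨hh.source, hh.source⟩, hh, rfl⟩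
  | succ p ih =>
    intro A _ _ h hh
    rw [Nat.add_right_comm] at hh
    obtain ⟨hA, C, _, _, f, g, hf, hg, rfl⟩ := hh
    obtain ⟨D, _, _, f', g', hf', hg', rfl⟩ := ih hg
    exact ⟨D, _, _, f' ∘ₗ f, g', ⟨hA, C, _, _, f, f', hf, hf', rfl⟩, hg', rfl⟩

/-- The Harada–Sai lemma. -/
lemma exists_length_range_add_le {r : ℕ} (hr : r ≤ c) : ∃ N : ℕ, ∀ (A B : Type u)
    [AddCommGroup A] [Module R A] [AddCommGroup B] [Module R B] (h : A →ₗ[R] B),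
    IsNonisoComp R c N h → Module.length R (LinearMap.range h) + r ≤ c := by
  induction r with
  | zero =>
    refine ⟨0, fun A B _ _ _ _ h hh => ?_⟩
    rw [Nat.cast_zero, add_zero]
    exact (Module.length_le_of_injective _ (LinearMap.range h).injective_subtype).trans hh.2.2
  | succ r ih =>
    obtain ⟨N, hN⟩ := ih (by omega)
    refine ⟨N + (N + 1), fun A B _ _ _ _ h hh => ?_⟩
    obtain ⟨C, _, _, f, w, hf, ⟨hC, D, _, _, s, g, hs, hg, rfl⟩, rfl⟩ := hh.exists_comp
    have hD := hg.source
    by_contra hlt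
    have h1 := hN _ _ f hf
    have h2 := hN _ _ g hg
    let h := (g ∘ₗ s) ∘ₗ f
    have hhg : LinearMap.range h ≤ LinearMap.range g := by
      rintro _ ⟨x, rfl⟩
      exact ⟨_, rfl⟩
    let π : LinearMap.range f →ₗ[R] LinearMap.range h :=
      ((g ∘ₗ s) ∘ₗ (LinearMap.range f).subtype).codRestrict _ (by
        rintro ⟨_, x, rfl⟩
        exact ⟨x, rfl⟩)
    have hπ : Function.Surjective π := by
      rintro ⟨_, x, rfl⟩
      exact ⟨⟨f x, x, rfl⟩, rfl⟩
    have hle : ∀ {a : ℕ∞}, a + r ≤ c → a ≤ Module.length R (LinearMap.range h) := by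
      intro a ha
      have h3 : (c : ℕ∞) < Module.length R (LinearMap.range h) + (r + 1 : ℕ) := not_le.1 hlt
      generalize Module.length R (LinearMap.range h) = d at h3
      induction d with
      | top => exact le_top
      | coe d =>
        induction a with
        | top => simp at ha
        | coe a =>
          norm_cast at *
          omega
    have hf1 : LinearMap.ker π = ⊥ := by
      have e1 := Module.length_eq_add_of_exact (LinearMap.ker π).subtype π
        (LinearMap.ker π).injective_subtype hπ (LinearMap.exact_subtype_ker_map π)
      have e2 := hle h1
      have e3 : Module.length R (LinearMap.range f) ≠ ⊤ := fun e => by simp [e] at h1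
      have e4 := Module.length_le_of_surjective π hπ
      have e5 := le_antisymm e2 e4
      rw [← Submodule.subsingleton_iff_eq_bot, ← Module.length_eq_zero_iff (R := R)]
      refine ENat.add_left_injective_of_ne_top (e5 ▸ e3) ?_
      change _ + _ = 0 + _
      rw [← e1, zero_add, e5]
    have hg1 : LinearMap.range h = LinearMap.range g := by
      refine eq_of_le_of_not_lt hhg fun hne => ?_
      have e3 : Module.length R (LinearMap.range g) ≠ ⊤ := fun e => by simp [e] at h2
      have h3 := hle h2
      rw [Module.length_submodule] at e3 h3
      rw [Module.length_submodule] at h3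
      exact absurd (Order.height_strictMono hne ((Order.height_mono hne.le).trans_lt
        (lt_top_iff_ne_top.2 e3))) (not_lt.2 h3)
    have key : ∀ x, ∃ a, g (s (f a)) = g x := fun x => by
      have : g x ∈ LinearMap.range h := hg1 ▸ ⟨x, rfl⟩
      exact this
    have hinj : ∀ a, g (s (f a)) = 0 → f a = 0 := fun a ha => by
      have : (⟨f a, a, rfl⟩ : LinearMap.range f) ∈ LinearMap.ker π := Subtype.ext ha
      rw [hf1, Submodule.mem_bot] at this
      exact congrArg Subtype.val this
    have hCc : IsCompl (LinearMap.range f) (LinearMap.ker (g ∘ₗ s)) := by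
      constructor
      · rw [Submodule.disjoint_def]
        rintro _ ⟨a, rfl⟩ ha
        exact hinj a ha
      · rw [codisjoint_iff, eq_top_iff]
        intro x _
        obtain ⟨a, ha⟩ := key (s x)
        rw [← add_sub_cancel (f a) x]
        refine Submodule.add_mem_sup ⟨a, rfl⟩ ?_
        rw [LinearMap.mem_ker, map_sub, sub_eq_zero]
        exact ha.symm
    rcases hC.1.2 _ _ hCc with h0 | h0
    · refine hlt ?_
      have : (g ∘ₗ s) ∘ₗ f = 0 := by
        rw [LinearMap.range_eq_bot.1 h0, LinearMap.comp_zero]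
      rw [this, LinearMap.range_zero, Module.length_eq_zero_iff.2 inferInstance, zero_add]
      exact_mod_cast hr
    have hgs : ∀ x, g (s x) = 0 → x = 0 := fun x hx => by
      have : x ∈ LinearMap.ker (g ∘ₗ s) := hx
      rwa [h0, Submodule.mem_bot] at this
    have hDc : IsCompl (LinearMap.range s) (LinearMap.ker g) := by
      constructor
      · rw [Submodule.disjoint_def]
        rintro _ ⟨a, rfl⟩ ha
        rw [hgs a ha, map_zero]
      · rw [codisjoint_iff, eq_top_iff]
        intro x _
        obtain ⟨a, ha⟩ := key x
        rw [← add_sub_cancel (s (f a)) x]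
        refine Submodule.add_mem_sup ⟨_, rfl⟩ ?_
        rw [LinearMap.mem_ker, map_sub, sub_eq_zero]
        exact ha.symm
    have hsi : Function.Injective s := by
      rw [injective_iff_map_eq_zero]
      intro x hx
      exact hgs x (by rw [hx, map_zero])
    rcases hD.1.2 _ _ hDc with h3 | h3
    · have := hC.1.1
      obtain ⟨x, hx⟩ := exists_ne (0 : C)
      exact hx (hsi (by rw [LinearMap.range_eq_bot.1 h3]; rfl))
    · rw [h3] at hDc
      exact hs ⟨hsi, LinearMap.range_eq_top.1 (eq_top_of_isCompl_bot hDc)⟩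

variable (R c) in
lemma exists_isNonisoComp_eq_zero : ∃ N : ℕ, ∀ (A B : Type u)
    [AddCommGroup A] [Module R A] [AddCommGroup B] [Module R B] (h : A →ₗ[R] B),
    IsNonisoComp R c N h → h = 0 := by
  obtain ⟨N, hN⟩ := exists_length_range_add_le (R := R) (le_refl c)
  refine ⟨N, fun A B _ _ _ _ h hh => ?_⟩
  rw [← LinearMap.range_eq_bot, ← Submodule.subsingleton_iff_eq_bot,
    ← Module.length_eq_zero_iff (R := R)]
  have h1 := hN A B h hh
  generalize Module.length R (LinearMap.range h) = d at h1
  induction d with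
  | top => simp at h1
  | coe d =>
    norm_cast at *
    omega

end HaradaSai

section Descent

variable {R : Type u} [CommRing R] [IsNoetherianRing R] [IsLocalRing R] {ys : List R} {a : ℕ}

omit [IsNoetherianRing R] in
lemma Setup.ofList_le (S : Setup R ys a) : Ideal.ofList ys ≤ maximalIdeal R :=
  Ideal.span_le.2 S.mem

/-- Modulo the maximal ideal, there is an almost split map from a Cohen-Macaulay module onto any
indecomposable Cohen-Macaulay module. -/
lemma Setup.exists_almost_split_modulo [IsAdicComplete (maximalIdeal R) R] (S : Setup R ys a)
    (hk : HasApprox R ys (ResidueField R))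
    (hL : ∀ (M N : Type u) [AddCommGroup M] [Module R M] [AddCommGroup N] [Module R N],
      IsCM R ys M → IsCM R ys N → LiftsModulo R (Ideal.ofList ys) M N (maximalIdeal R))
    {X : Type u} [AddCommGroup X] [Module R X] (hX : IsCM R ys X) (hXi : IsIndecomposable R X) :
    ∃ (V : Type u) (_ : AddCommGroup V) (_ : Module R V) (v : V →ₗ[R] X), IsCM R ys V ∧
      (∀ t : X →ₗ[R] V, ¬ ∀ x, v (t x) - x ∈ maximalIdeal R • (⊤ : Submodule R X)) ∧
      ∀ (M : Type u) [AddCommGroup M] [Module R M], IsCM R ys M → IsIndecomposable R M →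
        ¬ Nonempty (M ≃ₗ[R] X) → ∀ h : M →ₗ[R] X, ∃ g : M →ₗ[R] V,
          ∀ x, v (g x) - h x ∈ maximalIdeal R • (⊤ : Submodule R X) := by
  have hJ := S.ofList_le
  have hl := S.length_quotient_ne_top
  have := hX.1
  have := hXi.1
  obtain ⟨n, hn⟩ : ∃ n : ℕ, maximalIdeal R ^ n ≤ Ideal.ofList ys := by
    refine ⟨(Module.length R (R ⧸ Ideal.ofList ys)).toNat, fun r hr => ?_⟩
    have := pow_smul_eq_zero_of_length_le (ENat.natCast_toNat hl).ge hr
      (Submodule.Quotient.mk 1 : R ⧸ Ideal.ofList ys)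
    rwa [← Submodule.Quotient.mk_smul, Submodule.Quotient.mk_eq_zero, smul_eq_mul, mul_one] at this
  obtain ⟨B, _, _, hB, β, hβ, hβM⟩ := exists_right_almost_split (X := Red R (Ideal.ofList ys) X)
    hJ hn hl finKilled_red (isIndecomposable_red hJ hXi (hL _ _ hX hX))
  have := hB.1
  have := hB.isArtinian hl
  obtain ⟨V, _, _, p, hV, hp, hpL⟩ := S.hasApprox hk
    (isFiniteLength_iff_isNoetherian_isArtinian.2 ⟨(inferInstance : IsNoetherian R B), this⟩)
  obtain ⟨v, hv⟩ := hL V X hV hX (β ∘ₗ p)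
  refine ⟨V, _, _, v, hV, fun t ht => hβ ?_, fun M _ _ hM hMi hMX h => ?_⟩
  · let s : Red R (Ideal.ofList ys) X →ₗ[R] B :=
      Submodule.liftQ _ (p ∘ₗ t) (Submodule.smul_le.2 fun r hr x _ => by
        rw [LinearMap.mem_ker, map_smul, hB.2 r hr])
    have hb : Function.Bijective (β ∘ₗ s) := by
      refine bijective_of_sub_mem fun x => ?_
      obtain ⟨x, rfl⟩ := Submodule.Quotient.mk_surjective _ x
      obtain ⟨m, hm⟩ := Submodule.Quotient.mk_surjective _ (β (p (t x)))
      have h1 : (β ∘ₗ s) (Submodule.Quotient.mk x) = Submodule.Quotient.mk m := hm.symm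
      rw [h1, ← Submodule.Quotient.mk_sub, mk_mem_smul_top_iff hJ]
      have := sub_mem (ht x) (hv (t x) m hm)
      simpa using this
    refine ⟨s ∘ₗ (LinearEquiv.ofBijective _ hb).symm.toLinearMap, ?_⟩
    exact LinearMap.ext fun y => (LinearEquiv.ofBijective _ hb).apply_symm_apply y
  · have := hM.1
    obtain ⟨g₀, hg₀⟩ := hβM _ _ _ finKilled_red (redMap (Ideal.ofList ys) h) fun ⟨s, hs⟩ =>
      hMX (nonempty_linearEquiv_of_redMap_comp_eq_id hJ hMi hs (hL _ _ hX hM))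
    obtain ⟨g, hg⟩ := (hpL M hM).lift p hp (LinearEquiv.refl _ _) (g₀ ∘ₗ Submodule.mkQ _)
    refine ⟨g, fun x => hv _ _ ?_⟩
    have h1 : p (g x) = g₀ (Submodule.Quotient.mk x) := LinearMap.congr_fun hg x
    rw [LinearMap.comp_apply, h1, ← LinearMap.comp_apply, hg₀, redMap_mk]

variable (R ys) in
/-- There is a map from `M` to the residue field which factors through `X` and then through a map
whose reduction is a composite of `n` nonbijective maps. -/
def ReachedFrom (c n : ℕ) (M X : Type u) [AddCommGroup M] [Module R M] [AddCommGroup X]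
    [Module R X] : Prop :=
  IsCM R ys X ∧ IsIndecomposable R X ∧ ∃ (D : Type u) (_ : AddCommGroup D) (_ : Module R D)
    (h : M →ₗ[R] X) (φ : X →ₗ[R] D) (ψ : D →ₗ[R] ResidueField R),
    IsNonisoComp R c n (redMap (Ideal.ofList ys) φ) ∧ ∃ x, ψ (φ (h x)) ≠ 0

omit [IsNoetherianRing R] in
lemma smul_residueField_eq_zero {r : R} (hr : r ∈ maximalIdeal R) (z : ResidueField R) :
    r • z = 0 := by
  rw [Algebra.smul_def, ResidueField.algebraMap_eq, (residue_eq_zero_iff r).2 hr, zero_mul]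

omit [IsNoetherianRing R] in
lemma apply_eq_zero_of_mem_smul_top {M : Type u} [AddCommGroup M] [Module R M]
    (f : M →ₗ[R] ResidueField R) {x : M} (hx : x ∈ maximalIdeal R • (⊤ : Submodule R M)) :
    f x = 0 := by
  have : maximalIdeal R • (⊤ : Submodule R M) ≤ LinearMap.ker f :=
    Submodule.smul_le.2 fun r hr y _ => by
      rw [LinearMap.mem_ker, map_smul, smul_residueField_eq_zero hr]
  exact this hx

omit [IsNoetherianRing R] in
lemma exists_ne_zero_to_residueField (M : Type u) [AddCommGroup M] [Module R M] [Module.Finite R M]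
    [Nontrivial M] : ∃ (f : M →ₗ[R] ResidueField R) (x : M), f x ≠ 0 := by
  obtain ⟨C, hC⟩ := IsCoatomic.exists_coatom (Submodule R M)
  obtain ⟨I, hI, ⟨e⟩⟩ := isSimpleModule_iff_quot_maximal.1 (isSimpleModule_iff_isCoatom.2 hC)
  rw [eq_maximalIdeal hI] at e
  obtain ⟨x, -, hx⟩ := SetLike.exists_of_lt hC.1.lt_top
  refine ⟨e.toLinearMap ∘ₗ C.mkQ, x, fun h => hx ?_⟩
  rw [← Submodule.Quotient.mk_eq_zero]
  exact e.injective (h.trans (map_zero e).symm)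

lemma exists_reachedFrom_zero {c : ℕ} (hk : HasApprox R ys (ResidueField R))
    (hc : ∀ (X : Type u) [AddCommGroup X] [Module R X], IsCM R ys X → IsIndecomposable R X →
      ShortIndecomposable R c (Red R (Ideal.ofList ys) X)) :
    ∃ l : List (ModuleCat.{u} R), ∀ (M : Type u) [AddCommGroup M] [Module R M], IsCM R ys M →
      IsIndecomposable R M → ∃ X ∈ l, ReachedFrom R ys c 0 M X := by
  obtain ⟨V, _, _, p, hV, hp, hpL⟩ := hk
  have := hV.1
  obtain ⟨l, hl, hl1⟩ := exists_indecomposable_idempotents R V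
  refine ⟨l.map fun e => ModuleCat.of R (LinearMap.range e), fun M _ _ hM hMi => ?_⟩
  have := hM.1
  have := hMi.1
  obtain ⟨f, x, hfx⟩ := exists_ne_zero_to_residueField (R := R) M
  obtain ⟨g, hg⟩ := (hpL M hM).lift p hp (LinearEquiv.refl _ _) f
  have h1 : ∃ e ∈ l, p (e (g x)) ≠ 0 := by
    by_contra! h0
    apply hfx
    rw [← hg, LinearMap.comp_apply, ← LinearMap.id_apply (R := R) (g x), ← hl1, list_sum_apply,
      map_list_sum, List.map_map]
    refine List.sum_eq_zero fun z hz => ?_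
    obtain ⟨e, he, rfl⟩ := List.mem_map.1 hz
    exact h0 e he
  obtain ⟨e, he, hex⟩ := h1
  have hE : IsCM R ys (LinearMap.range e) := hV.of_retract (rangeRestrict_comp_subtype (hl e he).1)
  refine ⟨_, List.mem_map_of_mem he, hE, (hl e he).2, LinearMap.range e, _, _,
    e.rangeRestrict ∘ₗ g, LinearMap.id, p ∘ₗ (LinearMap.range e).subtype,
    ⟨hc _ hE (hl e he).2, hc _ hE (hl e he).2⟩, x, hex⟩

lemma Setup.exists_reachedFrom_succ [IsAdicComplete (maximalIdeal R) R] (S : Setup R ys a)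
    (hk : HasApprox R ys (ResidueField R))
    (hL : ∀ (M N : Type u) [AddCommGroup M] [Module R M] [AddCommGroup N] [Module R N],
      IsCM R ys M → IsCM R ys N → LiftsModulo R (Ideal.ofList ys) M N (maximalIdeal R))
    {c : ℕ} (hc : ∀ (X : Type u) [AddCommGroup X] [Module R X], IsCM R ys X →
      IsIndecomposable R X → ShortIndecomposable R c (Red R (Ideal.ofList ys) X))
    (n : ℕ) (X : ModuleCat.{u} R) :
    ∃ l : List (ModuleCat.{u} R), ∀ (M : Type u) [AddCommGroup M] [Module R M], IsCM R ys M →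
      IsIndecomposable R M → ReachedFrom R ys c n M X →
        Nonempty (M ≃ₗ[R] X) ∨ ∃ Y ∈ l, ReachedFrom R ys c (n + 1) M Y := by
  by_cases hX : IsCM R ys X ∧ IsIndecomposable R X
  swap
  · exact ⟨[], fun M _ _ _ _ h => absurd ⟨h.1, h.2.1⟩ hX⟩
  have := hX.1.1
  obtain ⟨V, _, _, v, hV, hvt, hvM⟩ := S.exists_almost_split_modulo hk hL hX.1 hX.2
  have := hV.1
  obtain ⟨l, hl, hl1⟩ := exists_indecomposable_idempotents R V
  refine ⟨l.map fun e => ModuleCat.of R (LinearMap.range e), fun M _ _ hM hMi hMX => ?_⟩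
  rw [or_iff_not_imp_left]
  intro hne
  obtain ⟨-, -, D, _, _, h, φ, ψ, hφ, x, hx⟩ := hMX
  obtain ⟨g, hg⟩ := hvM M hM hMi hne h
  have h1 : ∃ e ∈ l, ψ (φ (v (e (g x)))) ≠ 0 := by
    by_contra! h0
    apply hx
    have h2 := apply_eq_zero_of_mem_smul_top (ψ ∘ₗ φ) (hg x)
    rw [map_sub, sub_eq_zero] at h2
    change (ψ ∘ₗ φ) (h x) = 0
    rw [← h2, ← LinearMap.id_apply (R := R) (g x), ← hl1, list_sum_apply,
      map_list_sum, map_list_sum, List.map_map, List.map_map]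
    refine List.sum_eq_zero fun z hz => ?_
    obtain ⟨e, he, rfl⟩ := List.mem_map.1 hz
    exact h0 e he
  obtain ⟨e, he, hex⟩ := h1
  have hE : IsCM R ys (LinearMap.range e) := hV.of_retract (rangeRestrict_comp_subtype (hl e he).1)
  refine ⟨_, List.mem_map_of_mem he, hE, (hl e he).2, D, _, _,
    e.rangeRestrict ∘ₗ g, φ ∘ₗ v ∘ₗ (LinearMap.range e).subtype, ψ,
    ⟨hc _ hE (hl e he).2, _, _, _, redMap _ (v ∘ₗ (LinearMap.range e).subtype), redMap _ φ,
      fun hb => ?_, hφ, redMap_comp _ _ _⟩, x, hex⟩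
  obtain ⟨t, ht, -⟩ := exists_bijective_comp_of_redMap_comp_eq_id S.ofList_le
    (s := (LinearEquiv.ofBijective _ hb).symm.toLinearMap)
    (LinearMap.ext fun y => (LinearEquiv.ofBijective _ hb).apply_symm_apply y) (hL _ _ hX.1 hE)
  exact hvt ((LinearMap.range e).subtype ∘ₗ t) ht

theorem Setup.finiteMCMType [IsAdicComplete (maximalIdeal R) R] (S : Setup R ys a)
    (hk : HasApprox R ys (ResidueField R))
    (hL : ∀ (M N : Type u) [AddCommGroup M] [Module R M] [AddCommGroup N] [Module R N],
      IsCM R ys M → IsCM R ys N → LiftsModulo R (Ideal.ofList ys) M N (maximalIdeal R))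
    {c : ℕ} (hc : ∀ (X : Type u) [AddCommGroup X] [Module R X], IsCM R ys X →
      IsIndecomposable R X → ShortIndecomposable R c (Red R (Ideal.ofList ys) X)) :
    FiniteMCMType R := by
  have key : ∀ n : ℕ, ∃ l : List (ModuleCat.{u} R), ∀ (M : Type u) [AddCommGroup M] [Module R M],
      IsCM R ys M → IsIndecomposable R M → ∃ X ∈ l, Nonempty (M ≃ₗ[R] X) ∨
        ReachedFrom R ys c n M X := by
    intro n
    induction n with
    | zero =>
      obtain ⟨l, hl⟩ := exists_reachedFrom_zero hk hc
      refine ⟨l, fun M _ _ hM hMi => ?_⟩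
      obtain ⟨X, hX, h⟩ := hl M hM hMi
      exact ⟨X, hX, .inr h⟩
    | succ n ih =>
      obtain ⟨l, hl⟩ := ih
      choose L hLs using S.exists_reachedFrom_succ hk hL hc n
      refine ⟨l ++ l.flatMap L, fun M _ _ hM hMi => ?_⟩
      obtain ⟨X, hX, h⟩ := hl M hM hMi
      rcases h with h | h
      · exact ⟨X, List.mem_append_left _ hX, .inl h⟩
      · rcases hLs X M hM hMi h with h | ⟨Y, hY, h⟩
        · exact ⟨X, List.mem_append_left _ hX, .inl h⟩
        · exact ⟨Y, List.mem_append_right _ (List.mem_flatMap.2 ⟨X, hX, hY⟩), .inr h⟩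
  obtain ⟨N, hN⟩ := exists_isNonisoComp_eq_zero R c
  obtain ⟨l, hl⟩ := key N
  refine ⟨l.length, fun i => l.get i, fun i => inferInstance, fun i => inferInstance,
    fun M _ _ hMf hM hMi => ?_⟩
  obtain ⟨X, hX, h⟩ := hl M (S.isCM hM) hMi
  obtain ⟨i, rfl⟩ := List.get_of_mem hX
  refine ⟨i, h.resolve_right ?_⟩
  rintro ⟨-, -, D, _, _, h, φ, ψ, hφ, x, hx⟩
  refine hx (apply_eq_zero_of_mem_smul_top ψ (Submodule.smul_mono_left S.ofList_le ?_))
  rw [← Submodule.Quotient.mk_eq_zero, ← redMap_mk, hN _ _ _ hφ, LinearMap.zero_apply]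

end Descent

/-- Let `(R, 𝔪)` be a commutative noetherian complete Cohen-Macaulay local
ring with canonical module.  If the class of indecomposable maximal
Cohen-Macaulay `R`-modules is of bounded `h`-length, then `R` is of finite
maximal Cohen-Macaulay type. -/
theorem finite_mCM_type_of_bounded_hLength
    (R : Type u) [CommRing R] [IsNoetherianRing R] [IsLocalRing R]
    [IsAdicComplete (maximalIdeal R) R]
    (hCM : IsMCM R R)
    (ω : Type u) [AddCommGroup ω] [Module R ω] (hω : IsCanonicalModule R ω)
    (G : Type u) [AddCommGroup G] [Module R G]
    (αG : G →ₗ[R] ResidueField R) (hG : IsResidueApprox R G αG)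
    (b : ℕ) (hb : 0 < b)
    (hbound : ∀ (M : Type u) (_ : AddCommGroup M) (_ : Module R M),
      Module.Finite R M → IsMCM R M → IsIndecomposable R M →
        hLengthC R M G ≤ (b : WithBot ℕ∞)) :
    FiniteMCMType R := by
  obtain ⟨rs, hmem, hreg, hlen⟩ := hCM
  let xs := rs.map (· ^ b)
  have hxs : ∀ x ∈ xs, x ∈ maximalIdeal R ^ b := fun x hx => by
    obtain ⟨r, hr, rfl⟩ := List.mem_map.1 hx
    exact Ideal.pow_mem_pow (hmem r hr) b
  have hxs' : ∀ x ∈ xs, x ∈ maximalIdeal R := fun x hx => Ideal.pow_le_self hb.ne' (hxs x hx)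
  have S : Setup R (xs.map (· ^ 2)) b :=
    { mem := fun y hy => by
        obtain ⟨x, hx, rfl⟩ := List.mem_map.1 hy
        exact Ideal.pow_mem_of_mem _ (hxs' x hx) 2 two_pos
      len := by
        rw [List.length_map, List.length_map]
        exact hlen
      reg := isWeaklyRegular_map_pow _ 2 (isWeaklyRegular_map_pow _ b hreg.toIsWeaklyRegular)
      killed := fun M _ _ h1 h2 h3 => stablyKilled_of_hLengthC_le G (hbound M _ _ h1 h2 h3) }
  obtain ⟨t, ht⟩ := hG.2.2.1
  have hL : ∀ (M N : Type u) [AddCommGroup M] [Module R M] [AddCommGroup N] [Module R N],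
      IsCM R (xs.map (· ^ 2)) M → IsCM R (xs.map (· ^ 2)) N →
        LiftsModulo R (Ideal.ofList (xs.map (· ^ 2))) M N (maximalIdeal R) := by
    intro M N _ _ _ _ hM hN φ
    obtain ⟨ψ, hψ⟩ := exists_lift_modulo_ofList xs N (Submodule.mkQ _) (Submodule.mkQ_surjective _)
      (Submodule.ker_mkQ _) hN.2 (fun x hx => S.stablyKilled hM x (hxs x hx)) φ
    exact ⟨ψ, fun x n h => Submodule.smul_mono_left (Ideal.span_le.2 hxs') (hψ x n h)⟩
  refine S.finiteMCMType (S.hasApprox_residueField hG) hL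
    (c := b * (Module.length R (R ⧸ Ideal.ofList (xs.map (· ^ 2)))).toNat) fun X _ _ hX hXi => ?_
  have hXf := hX.1
  have := hXi.1
  refine ⟨isIndecomposable_red S.ofList_le hXi (hL X X hX hX), ?_⟩
  obtain ⟨n, hn, p, hp⟩ := exists_surjective_pi hb hX hXi hG.2.1 (S.cmLifts t _ ht)
    (length_stableHom_le G (hbound X _ _ hXf (S.isMCM hX) hXi))
  refine (length_quotient_smul_top_le _ hn hp).trans_eq ?_
  rw [Nat.cast_mul, ENat.natCast_toNat S.length_quotient_ne_top]

end BT
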